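/- Let 0 < ε < 1 and C > 0 be constants. There exist constants r₀ and c (depending only on C and ε) such that the following holds for all sufficiently large n. Let A = (a_{ij}) be an n×n real matrix with ρ_b(A) ≥ n^{−C}. Then there exist index sets I₀, J₀ ⊆ {1,…,n} with |I₀|, |J₀| ≤ r₀, index sets I, J ⊆ {1,…,n} with |I|, |J| ≥ n − c·n^ε, I ∩ I₀ = ∅ and J ∩ J₀ = ∅, nonzero integers k, l with |k|, |l| ≤ n^c, integers k_{i i₀} (i ∈ I, i₀ ∈ I₀) and l_{j₀ j} (j ∈ J, j₀ ∈ J₀) all of absolute value at most n^c, real numbers a'_{ij} (i ∈ I, j ∈ J), an integer s ≤ r₀ and real numbers g₁,…,g_s (independent of i), such that for every i ∈ I: (i) a_{ij} = a'_{ij}/(kl) − Σ_{i₀∈I₀} k_{i i₀} a_{i₀ j}/k − Σ_{j₀∈J₀} l_{j₀ j} a_{i j₀}/l for all j ∈ J; and (ii) all but at most c·n^ε of the numbers a'_{ij}, j ∈ J, can be written as Σ_{h=1}^s (p_h/q_h)·g_h with integers p_h, q_h satisfying q_h ≠ 0 and |p_h|, |q_h| ≤ n^c. -/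

import Mathlib

open scoped Classical BigOperators

noncomputable section

/-- The real number (±1) corresponding to a Boolean sign bit. -/
def signv (b : Bool) : ℝ := if b then 1 else -1

/-- The bilinear concentration probability `ρ_b(A) = sup_a P(Σ a_{ij} x_i y_j = a)`, where
`x` and `y` are vectors of iid Rademacher random variables. -/
def rhoB (n : ℕ) (A : Matrix (Fin n) (Fin n) ℝ) : ℝ :=
  ⨆ a : ℝ, ((Finset.univ.filter fun xy : (Fin n → Bool) × (Fin n → Bool) =>
      ∑ i, ∑ j, A i j * signv (xy.1 i) * signv (xy.2 j) = a).card : ℝ) / 2 ^ (2 * n)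

/-- `w` is a rational combination of `G`, with common denominator and numerators bounded by
`n ^ e`. -/
def RatSpan (n e : ℕ) (G : Finset ℝ) (w : ℝ) : Prop :=
  ∃ q : ℤ, ∃ p : ℝ → ℤ, q ≠ 0 ∧ |q| ≤ (n : ℤ) ^ e ∧ (∀ g, |p g| ≤ (n : ℤ) ^ e) ∧
    (q : ℝ) * w = ∑ g ∈ G, (p g : ℝ) * g

lemma int_pow_le_pow {n a b : ℕ} (hn : 2 ≤ n) (h : a ≤ b) : (n : ℤ) ^ a ≤ (n : ℤ) ^ b :=
  pow_le_pow_right₀ (by exact_mod_cast (by omega : 1 ≤ n)) h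

lemma one_le_int_pow {n : ℕ} (hn : 2 ≤ n) (a : ℕ) : 1 ≤ (n : ℤ) ^ a :=
  one_le_pow₀ (by exact_mod_cast (by omega : 1 ≤ n))

lemma le_pow_self_of_two_le {n : ℕ} (hn : 2 ≤ n) (K : ℕ) : K ≤ n ^ K :=
  (Nat.lt_pow_self (by omega)).le

lemma RatSpan.mono {n e e' : ℕ} (hn : 2 ≤ n) {G G' : Finset ℝ} {w : ℝ} (h : RatSpan n e G w)
    (he : e ≤ e') (hG : G ⊆ G') : RatSpan n e' G' w := by
  obtain ⟨q, p, hq, hq', hp, hw⟩ := h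
  have h1 := int_pow_le_pow hn he
  refine ⟨q, fun g => if g ∈ G then p g else 0, hq, hq'.trans h1, ?_, ?_⟩
  · intro g
    dsimp only
    split_ifs
    · exact (hp g).trans h1
    · simp
  · rw [hw, ← Finset.sum_subset hG]
    · exact Finset.sum_congr rfl fun g hg => by simp [hg]
    · intro g _ hg
      simp [hg]

lemma ratSpan_zero {n : ℕ} (hn : 2 ≤ n) (e : ℕ) (G : Finset ℝ) : RatSpan n e G 0 :=
  ⟨1, 0, one_ne_zero, by simpa using one_le_int_pow hn e, fun _ => by simp, by simp⟩

lemma ratSpan_of_mem {n : ℕ} (hn : 2 ≤ n) (e : ℕ) {G : Finset ℝ} {w : ℝ} (hw : w ∈ G) :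
    RatSpan n e G w := by
  refine ⟨1, fun g => if g = w then 1 else 0, one_ne_zero,
    by simpa using one_le_int_pow hn e, fun g => ?_, ?_⟩
  · have := one_le_int_pow hn e
    dsimp only
    split_ifs <;> simp <;> omega
  · rw [Finset.sum_eq_single_of_mem w hw]
    · simp
    · intro b _ hb
      simp [hb]

lemma RatSpan.add {n e e' : ℕ} (hn : 2 ≤ n) {G : Finset ℝ} {w w' : ℝ} (h : RatSpan n e G w)
    (h' : RatSpan n e' G w') : RatSpan n (e + e' + 1) G (w + w') := by
  obtain ⟨q, p, hq, hq1, hp, hw⟩ := h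
  obtain ⟨q', p', hq', hq1', hp', hw'⟩ := h'
  refine ⟨q * q', fun g => p g * q' + p' g * q, mul_ne_zero hq hq', ?_, ?_, ?_⟩
  · calc |q * q'| = |q| * |q'| := abs_mul _ _
      _ ≤ (n : ℤ) ^ e * (n : ℤ) ^ e' := by gcongr
      _ = (n : ℤ) ^ (e + e') := by ring
      _ ≤ _ := int_pow_le_pow hn (by omega)
  · intro g
    calc |p g * q' + p' g * q| ≤ |p g| * |q'| + |p' g| * |q| := by
          rw [← abs_mul, ← abs_mul]; exact abs_add_le _ _
      _ ≤ (n : ℤ) ^ e * (n : ℤ) ^ e' + (n : ℤ) ^ e' * (n : ℤ) ^ e := by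
          gcongr
          · exact hp g
          · exact hp' g
      _ = 2 * (n : ℤ) ^ (e + e') := by ring
      _ ≤ n * (n : ℤ) ^ (e + e') := by gcongr; exact_mod_cast hn
      _ = _ := by ring
  · push_cast
    rw [show (q : ℝ) * q' * (w + w') = q' * (q * w) + q * (q' * w') by ring, hw, hw',
      Finset.mul_sum, Finset.mul_sum, ← Finset.sum_add_distrib]
    exact Finset.sum_congr rfl fun g _ => by ring

lemma RatSpan.int_mul {n e e' : ℕ} (hn : 2 ≤ n) {G : Finset ℝ} {w : ℝ} (h : RatSpan n e G w)
    {m : ℤ} (hm : |m| ≤ (n : ℤ) ^ e') : RatSpan n (e + e') G (m * w) := by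
  obtain ⟨q, p, hq, hq1, hp, hw⟩ := h
  refine ⟨q, fun g => m * p g, hq, hq1.trans (int_pow_le_pow hn (by omega)), fun g => ?_, ?_⟩
  · rw [abs_mul, add_comm, pow_add]
    gcongr
    exact hp g
  · rw [mul_left_comm, hw, Finset.mul_sum]
    push_cast
    exact Finset.sum_congr rfl fun g _ => by ring

lemma RatSpan.of_int_mul {n e e' : ℕ} (hn : 2 ≤ n) {G : Finset ℝ} {w : ℝ} {m : ℤ} (hm0 : m ≠ 0)
    (hm : |m| ≤ (n : ℤ) ^ e') (h : RatSpan n e G (m * w)) : RatSpan n (e + e') G w := by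
  obtain ⟨q, p, hq, hq1, hp, hw⟩ := h
  refine ⟨q * m, p, mul_ne_zero hq hm0, ?_, fun g => (hp g).trans
    (int_pow_le_pow hn (by omega)), ?_⟩
  · rw [abs_mul, pow_add]
    gcongr
  · rw [← hw]; push_cast; ring

lemma RatSpan.neg {n e : ℕ} {G : Finset ℝ} {w : ℝ} (h : RatSpan n e G w) :
    RatSpan n e G (-w) := by
  obtain ⟨q, p, hq, hq1, hp, hw⟩ := h
  exact ⟨-q, p, neg_ne_zero.mpr hq, by rwa [abs_neg], hp, by push_cast; rw [neg_mul_neg, hw]⟩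

lemma ratSpan_sum {n e K : ℕ} (hn : 2 ≤ n) {G : Finset ℝ} {ι : Type*} (s : Finset ι)
    (hs : s.card ≤ K) {w : ι → ℝ} (h : ∀ a ∈ s, RatSpan n e G (w a)) :
    RatSpan n (K * (e + 1)) G (∑ a ∈ s, w a) := by
  have key : RatSpan n (s.card * (e + 1)) G (∑ a ∈ s, w a) := by
    clear hs
    induction s using Finset.induction_on with
    | empty => simpa using ratSpan_zero hn _ G
    | insert a s ha ih =>
      rw [Finset.sum_insert ha, Finset.card_insert_of_notMem ha]
      have h1 := h a (Finset.mem_insert_self _ _)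
      have h2 := ih fun b hb => h b (Finset.mem_insert_of_mem hb)
      refine (h1.add hn h2).mono hn ?_ subset_rfl
      ring_nf; omega
  exact key.mono hn (Nat.mul_le_mul_right _ hs) subset_rfl

lemma ratSpan_linearCombination {n e e' K : ℕ} (hn : 2 ≤ n) {G : Finset ℝ} {ι : Type*}
    (s : Finset ι) (hs : s.card ≤ K) {m : ι → ℤ} {w : ι → ℝ}
    (hm : ∀ a ∈ s, |m a| ≤ (n : ℤ) ^ e') (h : ∀ a ∈ s, RatSpan n e G (w a)) :
    RatSpan n (K * (e + e' + 1)) G (∑ a ∈ s, (m a : ℝ) * w a) :=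
  ratSpan_sum hn s hs fun a ha => (h a ha).int_mul hn (hm a ha)

open Matrix in
/-- Siegel's lemma with polynomial bounds. -/
lemma exists_int_vec_of_card_lt {n e K : ℕ} (hn : 2 ≤ n) {α β : Type*} [Fintype α] [Fintype β]
    (hab : Fintype.card α < Fintype.card β) (hK : Fintype.card β ≤ K) (M : α → β → ℤ)
    (hM : ∀ a b, |M a b| ≤ (n : ℤ) ^ e) :
    ∃ t : β → ℤ, t ≠ 0 ∧ (∀ b, |t b| ≤ (n : ℤ) ^ ((K + e) * K)) ∧ ∀ a, ∑ b, M a b * t b = 0 := by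
  by_cases h0 : Fintype.card α = 0
  · have : IsEmpty α := Fintype.card_eq_zero_iff.mp h0
    have hβ : Nonempty β := Fintype.card_pos_iff.mp (by omega)
    refine ⟨fun _ => 1, ?_, fun b => by simpa using one_le_int_pow hn _, fun a => isEmptyElim a⟩
    intro h
    exact one_ne_zero (congrFun h hβ.some)
  let _ : SeminormedAddCommGroup (Matrix α β ℤ) := Matrix.seminormedAddCommGroup
  obtain ⟨t, ht0, ht, htn⟩ := Int.Matrix.exists_ne_zero_int_vec_norm_le (Matrix.of M) hab (by omega)
  refine ⟨t, ht0, fun b => ?_, fun a => congrFun ht a⟩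
  have h1 : ‖Matrix.of M‖ ≤ (n : ℝ) ^ e := by
    rw [Matrix.norm_le_iff (by positivity)]
    intro i j
    rw [Int.norm_eq_abs]
    exact_mod_cast hM i j
  have hn1 : (1 : ℝ) ≤ n := by exact_mod_cast (by omega : 1 ≤ n)
  have h2 : ‖t‖ ≤ (n : ℝ) ^ ((K + e) * K) := by
    refine htn.trans ?_
    have hcard : (Fintype.card β : ℝ) ≤ (n : ℝ) ^ K := by
      exact_mod_cast hK.trans (le_pow_self_of_two_le hn K)
    have hb1 : (1 : ℝ) ≤ Fintype.card β := by exact_mod_cast (by omega : 1 ≤ Fintype.card β)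
    have hbase : (Fintype.card β : ℝ) * max 1 ‖Matrix.of M‖ ≤ (n : ℝ) ^ (K + e) := by
      rw [pow_add]
      gcongr
      exact max_le (one_le_pow₀ hn1) h1
    have hbase1 : (1 : ℝ) ≤ (Fintype.card β : ℝ) * max 1 ‖Matrix.of M‖ := by
      have : (1 : ℝ) ≤ max 1 ‖Matrix.of M‖ := le_max_left _ _
      nlinarith
    have hab' : (Fintype.card α : ℝ) + 1 ≤ Fintype.card β := by exact_mod_cast hab
    have hexp : (Fintype.card α : ℝ) / (Fintype.card β - Fintype.card α) ≤ (K : ℝ) := by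
      rw [div_le_iff₀ (by linarith)]
      have : (Fintype.card α : ℝ) ≤ K := by exact_mod_cast (by omega : Fintype.card α ≤ K)
      nlinarith [(Nat.cast_nonneg K : (0 : ℝ) ≤ K)]
    calc _ ≤ ((Fintype.card β : ℝ) * max 1 ‖Matrix.of M‖) ^ (K : ℝ) :=
          Real.rpow_le_rpow_of_exponent_le hbase1 hexp
      _ = ((Fintype.card β : ℝ) * max 1 ‖Matrix.of M‖) ^ K := Real.rpow_natCast _ _
      _ ≤ ((n : ℝ) ^ (K + e)) ^ K := by gcongr
      _ = _ := by rw [← pow_mul]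
  have h3 := (norm_le_pi_norm t b).trans h2
  rw [Int.norm_eq_abs] at h3
  exact_mod_cast h3

/-- More numbers than generators satisfy a nontrivial integer relation. -/
lemma exists_int_relation {n e R : ℕ} (hn : 2 ≤ n) {G : Finset ℝ} (hG : G.card ≤ R)
    (w : Fin (R + 1) → ℝ) (hw : ∀ b, RatSpan n e G (w b)) :
    ∃ t : Fin (R + 1) → ℤ, t ≠ 0 ∧ (∀ b, |t b| ≤ (n : ℤ) ^ ((R + 1 + e) * (R + 1) + e)) ∧
      ∑ b, (t b : ℝ) * w b = 0 := by
  choose q p hq hq1 hp hqp using hw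
  obtain ⟨t, ht0, ht, hts⟩ := exists_int_vec_of_card_lt (K := R + 1) hn (α := G)
    (β := Fin (R + 1)) (by simpa using Nat.lt_succ_of_le hG) (by simp)
    (fun g b => p b g) (fun g b => hp b g)
  refine ⟨fun b => t b * q b, ?_, fun b => ?_, ?_⟩
  · intro h
    apply ht0
    funext b
    have := congrFun h b
    simpa [hq b] using this
  · rw [abs_mul, pow_add]
    gcongr
    · exact ht b
    · exact hq1 b
  · calc ∑ b, ((t b * q b : ℤ) : ℝ) * w b = ∑ b, ∑ g ∈ G, (t b : ℝ) * ((p b g : ℝ) * g) := by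
          refine Finset.sum_congr rfl fun b _ => ?_
          rw [← Finset.mul_sum, ← hqp b]; push_cast; ring
      _ = ∑ g ∈ G, ((∑ b, p b g * t b : ℤ) : ℝ) * g := by
          rw [Finset.sum_comm]
          refine Finset.sum_congr rfl fun g _ => ?_
          push_cast
          rw [Finset.sum_mul]
          exact Finset.sum_congr rfl fun b _ => by ring
      _ = 0 := by
          refine Finset.sum_eq_zero fun g hg => ?_
          rw [hts ⟨g, hg⟩]; simp

/-- The partial signed sum over the coordinates in `S`. -/
def partialSum {n : ℕ} (v : Fin n → ℝ) (S : Finset (Fin n)) (y : Fin n → Bool) : ℝ :=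
  ∑ j ∈ S, v j * signv (y j)

/-- The (unnormalised) law of `partialSum v S` translated by `u`, as an element of `ℓ²(ℝ)`. -/
def lawVec {n : ℕ} (v : Fin n → ℝ) (S : Finset (Fin n)) (u : ℝ) : lp (fun _ : ℝ => ℝ) 2 :=
  ∑ y : Fin n → Bool, lp.single 2 (partialSum v S y + u) (1 : ℝ)

lemma inner_lawVec {n : ℕ} (v : Fin n → ℝ) (S : Finset (Fin n)) (u w : ℝ) :
    inner ℝ (lawVec v S u) (lawVec v S w) =
      ∑ y : Fin n → Bool, ∑ y' : Fin n → Bool,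
        if partialSum v S y + u = partialSum v S y' + w then (1 : ℝ) else 0 := by
  unfold lawVec
  rw [sum_inner]
  refine Finset.sum_congr rfl fun y _ => ?_
  rw [inner_sum]
  refine Finset.sum_congr rfl fun y' _ => ?_
  rw [lp.inner_single_left]
  simp [lp.single_apply, Pi.single_apply]

lemma inner_lawVec_add {n : ℕ} (v : Fin n → ℝ) (S : Finset (Fin n)) (u w z : ℝ) :
    inner ℝ (lawVec v S (u + z)) (lawVec v S (w + z)) =
      inner ℝ (lawVec v S u) (lawVec v S w) := by
  simp only [inner_lawVec, ← add_assoc, add_left_inj]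

lemma norm_lawVec_sq {n : ℕ} (v : Fin n → ℝ) (S : Finset (Fin n)) (u : ℝ) :
    ‖lawVec v S u‖ ^ 2 = ‖lawVec v S 0‖ ^ 2 := by
  rw [← real_inner_self_eq_norm_sq, ← real_inner_self_eq_norm_sq, ← inner_lawVec_add v S 0 0 u,
    zero_add]

lemma norm_lawVec_sub_add {n : ℕ} (v : Fin n → ℝ) (S : Finset (Fin n)) (u w z : ℝ) :
    ‖lawVec v S (u + z) - lawVec v S (w + z)‖ = ‖lawVec v S u - lawVec v S w‖ := by
  have : ‖lawVec v S (u + z) - lawVec v S (w + z)‖ ^ 2 = ‖lawVec v S u - lawVec v S w‖ ^ 2 := by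
    rw [norm_sub_sq_real, norm_sub_sq_real, inner_lawVec_add, norm_lawVec_sq v S (u + z),
      norm_lawVec_sq v S (w + z), norm_lawVec_sq v S u, norm_lawVec_sq v S w]
  exact (sq_eq_sq₀ (norm_nonneg _) (norm_nonneg _)).mp this

/-- Flipping one sign. -/
def flipAt {n : ℕ} (j : Fin n) (y : Fin n → Bool) : Fin n → Bool := Function.update y j (!y j)

lemma flipAt_involutive {n : ℕ} (j : Fin n) : Function.Involutive (flipAt j) := by
  intro y
  simp [flipAt]

lemma partialSum_flipAt {n : ℕ} (v : Fin n → ℝ) {S : Finset (Fin n)} {j : Fin n} (hj : j ∉ S)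
    (y : Fin n → Bool) : partialSum v S (flipAt j y) = partialSum v S y := by
  refine Finset.sum_congr rfl fun i hi => ?_
  rw [flipAt, Function.update_of_ne]
  rintro rfl
  exact hj hi

lemma two_smul_lawVec_insert {n : ℕ} (v : Fin n → ℝ) {S : Finset (Fin n)} {j : Fin n}
    (hj : j ∉ S) :
    (2 : ℝ) • lawVec v (insert j S) 0 = lawVec v S (v j) + lawVec v S (-v j) := by
  have h1 : lawVec v (insert j S) 0 =
      ∑ y : Fin n → Bool, lp.single 2 (partialSum v S y + v j * signv (y j)) (1 : ℝ) := by
    refine Finset.sum_congr rfl fun y _ => ?_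
    congr 1
    rw [partialSum, Finset.sum_insert hj, ← partialSum]
    ring
  have h2 : lawVec v (insert j S) 0 =
      ∑ y : Fin n → Bool, lp.single 2 (partialSum v S y - v j * signv (y j)) (1 : ℝ) := by
    rw [h1, ← Equiv.sum_comp (flipAt_involutive j).toPerm]
    refine Finset.sum_congr rfl fun y _ => ?_
    congr 1
    rw [Function.Involutive.coe_toPerm, partialSum_flipAt v hj, sub_eq_add_neg, ← mul_neg]
    congr 2
    cases h : y j <;> simp [flipAt, signv, h]
  rw [two_smul]
  nth_rewrite 1 [h1]
  rw [h2, lawVec, lawVec, ← Finset.sum_add_distrib, ← Finset.sum_add_distrib]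
  refine Finset.sum_congr rfl fun y _ => ?_
  cases h : y j
  · simp only [signv, Bool.false_eq_true, if_false, mul_neg, mul_one, sub_neg_eq_add]
    rw [add_comm]
  · simp only [signv, if_true, mul_one, sub_eq_add_neg]

lemma norm_lawVec_sub_two_mul {n : ℕ} (v : Fin n → ℝ) {S : Finset (Fin n)} {j : Fin n}
    (hj : j ∉ S) :
    ‖lawVec v S 0 - lawVec v S (2 * v j)‖ ^ 2 =
      4 * (‖lawVec v S 0‖ ^ 2 - ‖lawVec v (insert j S) 0‖ ^ 2) := by
  have h1 := norm_lawVec_sub_add v S 0 (2 * v j) (-v j)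
  rw [← h1, zero_add, show 2 * v j + -v j = v j by ring]
  have h2 := parallelogram_law_with_norm ℝ (lawVec v S (-v j)) (lawVec v S (v j))
  have h3 : ‖lawVec v S (-v j) + lawVec v S (v j)‖ = 2 * ‖lawVec v (insert j S) 0‖ := by
    rw [add_comm, ← two_smul_lawVec_insert v hj, norm_smul]; simp
  have h4 := norm_lawVec_sq v S (v j)
  have h5 := norm_lawVec_sq v S (-v j)
  rw [h3] at h2
  nlinarith

lemma norm_lawVec_insert_le {n : ℕ} (v : Fin n → ℝ) (S : Finset (Fin n)) (j : Fin n) :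
    ‖lawVec v (insert j S) 0‖ ^ 2 ≤ ‖lawVec v S 0‖ ^ 2 := by
  by_cases hj : j ∈ S
  · rw [Finset.insert_eq_of_mem hj]
  · have := norm_lawVec_sub_two_mul v hj
    nlinarith [sq_nonneg ‖lawVec v S 0 - lawVec v S (2 * v j)‖]

lemma norm_lawVec_union_le {n : ℕ} (v : Fin n → ℝ) (S T : Finset (Fin n)) :
    ‖lawVec v (T ∪ S) 0‖ ^ 2 ≤ ‖lawVec v S 0‖ ^ 2 := by
  induction T using Finset.induction_on with
  | empty => simp
  | insert j T _ ih =>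
    rw [Finset.insert_union]
    exact (norm_lawVec_insert_le v _ j).trans ih

lemma norm_lawVec_univ_le {n : ℕ} (v : Fin n → ℝ) (S : Finset (Fin n)) :
    ‖lawVec v Finset.univ 0‖ ^ 2 ≤ ‖lawVec v S 0‖ ^ 2 := by
  have h := norm_lawVec_union_le v S Finset.univ
  rwa [show Finset.univ ∪ S = Finset.univ by ext; simp] at h

lemma norm_lawVec_empty {n : ℕ} (v : Fin n → ℝ) : ‖lawVec v ∅ 0‖ ^ 2 = 4 ^ n := by
  rw [← real_inner_self_eq_norm_sq, inner_lawVec]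
  simp [partialSum, ← mul_pow]
  norm_num

lemma sq_card_le_norm_lawVec {n : ℕ} (v : Fin n → ℝ) (a : ℝ) :
    ((Finset.univ.filter fun y : Fin n → Bool => ∑ j, v j * signv (y j) = a).card : ℝ) ^ 2 ≤
      ‖lawVec v Finset.univ 0‖ ^ 2 := by
  rw [← real_inner_self_eq_norm_sq, inner_lawVec, sq, Finset.card_filter, Nat.cast_sum,
    Finset.sum_mul_sum]
  refine Finset.sum_le_sum fun y _ => Finset.sum_le_sum fun y' _ => ?_
  have e1 : ∀ y : Fin n → Bool, partialSum v Finset.univ y = ∑ j, v j * signv (y j) :=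
    fun _ => rfl
  rw [e1, e1]
  by_cases h1 : ∑ j, v j * signv (y j) = a <;> by_cases h2 : ∑ j, v j * signv (y' j) = a
  · simp [h1, h2]
  · simp [h2]; split_ifs <;> norm_num
  · simp [h1]; split_ifs <;> norm_num
  · simp [h1]; split_ifs <;> norm_num

lemma exists_small_set_of_decrement {n m : ℕ} (v : Fin n → ℝ) (a η : ℝ) (hη1 : η ≤ 1)
    (h : (1 - η) ^ m * 4 ^ n < ((Finset.univ.filter fun y : Fin n → Bool =>
      ∑ j, v j * signv (y j) = a).card : ℝ) ^ 2) :
    ∃ S : Finset (Fin n), S.card ≤ m ∧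
      ∀ j ∉ S, (1 - η) * ‖lawVec v S 0‖ ^ 2 ≤ ‖lawVec v (insert j S) 0‖ ^ 2 := by
  by_contra! hcon
  have key : ∀ k ≤ m, ∃ S : Finset (Fin n), S.card = k ∧
      ‖lawVec v S 0‖ ^ 2 ≤ (1 - η) ^ k * 4 ^ n := by
    intro k
    induction k with
    | zero => exact fun _ => ⟨∅, by simp, by rw [norm_lawVec_empty]; simp⟩
    | succ k ih =>
      intro hk
      obtain ⟨S, hS, hSn⟩ := ih (by omega)
      obtain ⟨j, hj, hlt⟩ := hcon S (by omega)
      refine ⟨insert j S, by rw [Finset.card_insert_of_notMem hj, hS], hlt.le.trans ?_⟩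
      rw [pow_succ' (1 - η), mul_assoc]
      exact mul_le_mul_of_nonneg_left hSn (by linarith)
  obtain ⟨S, _, hS⟩ := key m le_rfl
  have h1 := sq_card_le_norm_lawVec v a
  have h2 := norm_lawVec_univ_le v S
  linarith

lemma norm_lawVec_sub_triangle {n : ℕ} (v : Fin n → ℝ) (S : Finset (Fin n)) (u w : ℝ) :
    ‖lawVec v S 0 - lawVec v S (u + w)‖ ≤
      ‖lawVec v S 0 - lawVec v S u‖ + ‖lawVec v S 0 - lawVec v S w‖ := by
  have h := norm_lawVec_sub_add v S 0 w u
  rw [zero_add, add_comm w u] at h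
  rw [← h]
  exact norm_sub_le_norm_sub_add_norm_sub _ _ _

lemma norm_lawVec_sub_neg {n : ℕ} (v : Fin n → ℝ) (S : Finset (Fin n)) (u : ℝ) :
    ‖lawVec v S 0 - lawVec v S (-u)‖ = ‖lawVec v S 0 - lawVec v S u‖ := by
  have h := norm_lawVec_sub_add v S 0 (-u) u
  rw [← h, norm_sub_rev]; simp

lemma norm_lawVec_sub_int_mul {n : ℕ} (v : Fin n → ℝ) (S : Finset (Fin n)) (u : ℝ) (m : ℤ) :
    ‖lawVec v S 0 - lawVec v S (m * u)‖ ≤ |(m : ℝ)| * ‖lawVec v S 0 - lawVec v S u‖ := by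
  have hnat : ∀ k : ℕ, ‖lawVec v S 0 - lawVec v S (k * u)‖ ≤
      k * ‖lawVec v S 0 - lawVec v S u‖ := by
    intro k
    induction k with
    | zero => simp
    | succ k ih =>
      push_cast
      rw [add_mul, one_mul, add_mul, one_mul]
      exact (norm_lawVec_sub_triangle v S _ _).trans (by linarith)
  obtain ⟨k, rfl | rfl⟩ := m.eq_nat_or_neg
  · simpa using hnat k
  · simpa [norm_lawVec_sub_neg] using hnat k

lemma norm_lawVec_sub_sum {n : ℕ} (v : Fin n → ℝ) (S : Finset (Fin n)) (δ : ℝ)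
    (h : ∀ j ∉ S, ‖lawVec v S 0 - lawVec v S (2 * v j)‖ ≤ δ) (t : Fin n → ℤ)
    (F : Finset (Fin n)) (hF : Disjoint F S) :
    ‖lawVec v S 0 - lawVec v S (2 * ∑ j ∈ F, (t j : ℝ) * v j)‖ ≤
      (∑ j ∈ F, |(t j : ℝ)|) * δ := by
  induction F using Finset.induction_on with
  | empty => simp
  | insert j F hj ih =>
    rw [Finset.sum_insert hj, Finset.sum_insert hj]
    rw [Finset.disjoint_insert_left] at hF
    have h1 := norm_lawVec_sub_triangle v S ((t j : ℝ) * (2 * v j)) (2 * ∑ j ∈ F, (t j : ℝ) * v j)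
    have h2 := norm_lawVec_sub_int_mul v S (2 * v j) (t j)
    have h3 := mul_le_mul_of_nonneg_left (h j hF.1) (abs_nonneg (t j : ℝ))
    have h4 := ih hF.2
    rw [show 2 * ((t j : ℝ) * v j + ∑ j ∈ F, (t j : ℝ) * v j) =
      (t j : ℝ) * (2 * v j) + 2 * ∑ j ∈ F, (t j : ℝ) * v j by ring]
    linarith

/-- The popular differences are few. -/
lemma exists_finset_of_large_inner {n : ℕ} (v : Fin n → ℝ) (S : Finset (Fin n)) :
    ∃ U : Finset ℝ, (U.card : ℝ) * ‖lawVec v S 0‖ ^ 2 ≤ 2 * 4 ^ n ∧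
      ∀ u, ‖lawVec v S 0 - lawVec v S (2 * u)‖ ≤ ‖lawVec v S 0‖ → u ∈ U := by
  set N := ‖lawVec v S 0‖ ^ 2 with hN
  let D : Finset ℝ := Finset.univ.image fun p : (Fin n → Bool) × (Fin n → Bool) =>
    (partialSum v S p.1 - partialSum v S p.2) / 2
  let U := D.filter fun u => N / 2 ≤ inner ℝ (lawVec v S 0) (lawVec v S (2 * u))
  have hinner : ∀ u, inner ℝ (lawVec v S 0) (lawVec v S (2 * u)) =
      ∑ p : (Fin n → Bool) × (Fin n → Bool),
        if (partialSum v S p.1 - partialSum v S p.2) / 2 = u then (1 : ℝ) else 0 := by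
    intro u
    rw [inner_lawVec, Fintype.sum_prod_type]
    refine Finset.sum_congr rfl fun y _ => Finset.sum_congr rfl fun y' _ => ?_
    refine if_congr ?_ rfl rfl
    rw [div_eq_iff two_ne_zero]
    constructor <;> intro h <;> linarith
  have hNpos : 0 < N := by
    have h1 : ‖lawVec v S 0‖ ^ 2 = ∑ y : Fin n → Bool, ∑ y' : Fin n → Bool,
        if partialSum v S y + 0 = partialSum v S y' + 0 then (1 : ℝ) else 0 := by
      rw [← real_inner_self_eq_norm_sq, inner_lawVec]
    rw [hN, h1]
    refine Finset.sum_pos' (fun y _ => Finset.sum_nonneg fun y' _ => by split_ifs <;> norm_num)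
      ⟨fun _ => true, Finset.mem_univ _, ?_⟩
    refine Finset.sum_pos' (fun y' _ => by split_ifs <;> norm_num)
      ⟨fun _ => true, Finset.mem_univ _, by simp⟩
  refine ⟨U, ?_, fun u hu => ?_⟩
  · have h1 : (U.card : ℝ) * (N / 2) ≤
        ∑ u ∈ U, inner ℝ (lawVec v S 0) (lawVec v S (2 * u)) := by
      rw [← nsmul_eq_mul]
      exact Finset.card_nsmul_le_sum _ _ _ fun u hu => (Finset.mem_filter.mp hu).2
    have h2 : ∑ u ∈ U, inner ℝ (lawVec v S 0) (lawVec v S (2 * u)) ≤ (4 : ℝ) ^ n := by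
      simp only [hinner]
      rw [Finset.sum_comm]
      calc _ ≤ ∑ p : (Fin n → Bool) × (Fin n → Bool), (1 : ℝ) := by
            refine Finset.sum_le_sum fun p _ => ?_
            rw [Finset.sum_ite_eq]
            split_ifs <;> norm_num
        _ = 4 ^ n := by
            simp [← mul_pow]
    linarith
  · have h1 : N / 2 ≤ inner ℝ (lawVec v S 0) (lawVec v S (2 * u)) := by
      have h2 := norm_sub_sq_real (lawVec v S 0) (lawVec v S (2 * u))
      have h3 := norm_lawVec_sq v S (2 * u)
      have h4 : ‖lawVec v S 0 - lawVec v S (2 * u)‖ ^ 2 ≤ ‖lawVec v S 0‖ ^ 2 := by gcongr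
      rw [hN]; linarith
    refine Finset.mem_filter.mpr ⟨?_, h1⟩
    have h5 : (0 : ℝ) < ∑ p : (Fin n → Bool) × (Fin n → Bool),
        if (partialSum v S p.1 - partialSum v S p.2) / 2 = u then (1 : ℝ) else 0 := by
      rw [← hinner]; linarith
    obtain ⟨p, _, hp⟩ := Finset.exists_ne_zero_of_sum_ne_zero h5.ne'
    refine Finset.mem_image.mpr ⟨p, Finset.mem_univ _, ?_⟩
    by_contra hne
    simp [hne] at hp

/-- If a signed sum concentrates, then outside a small set of coordinates all short integer
combinations lie in a small set. -/
lemma exists_finset_short_combinations {n m K : ℕ} (hK : 1 ≤ K) (v : Fin n → ℝ) (a : ℝ)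
    (h : (1 - 1 / (4 * (K : ℝ) ^ 4)) ^ m * 4 ^ n < ((Finset.univ.filter fun y : Fin n → Bool =>
      ∑ j, v j * signv (y j) = a).card : ℝ) ^ 2) :
    ∃ S : Finset (Fin n), S.card ≤ m ∧ ∃ U : Finset ℝ,
      (U.card : ℝ) * ((Finset.univ.filter fun y : Fin n → Bool =>
        ∑ j, v j * signv (y j) = a).card : ℝ) ^ 2 ≤ 2 * 4 ^ n ∧
      ∀ t : Fin n → ℤ, (∀ j ∈ S, t j = 0) → ∑ j, |t j| ≤ K * K → ∑ j, (t j : ℝ) * v j ∈ U := by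
  have hK' : (1 : ℝ) ≤ K := by exact_mod_cast hK
  have hη1 : 1 / (4 * (K : ℝ) ^ 4) ≤ 1 := by
    rw [div_le_one (by positivity)]
    nlinarith [one_le_pow₀ hK' (n := 4)]
  obtain ⟨S, hSm, hS⟩ := exists_small_set_of_decrement v a _ hη1 h
  obtain ⟨U, hU, hUm⟩ := exists_finset_of_large_inner v S
  refine ⟨S, hSm, U, ?_, fun t ht htK => hUm _ ?_⟩
  · refine le_trans (mul_le_mul_of_nonneg_left ?_ (Nat.cast_nonneg _)) hU
    exact (sq_card_le_norm_lawVec v a).trans (norm_lawVec_univ_le v S)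
  · set x := ‖lawVec v S 0‖ with hx
    have hx0 : 0 ≤ x := norm_nonneg _
    have hj : ∀ j ∉ S, ‖lawVec v S 0 - lawVec v S (2 * v j)‖ ≤ x / (K : ℝ) ^ 2 := by
      intro j hj
      have h1 := norm_lawVec_sub_two_mul v hj
      have h2 := hS j hj
      refine le_of_sq_le_sq ?_ (by positivity)
      rw [h1, div_pow, ← pow_mul]
      have h3 : x ^ 2 / (K : ℝ) ^ (2 * 2) = 4 * (1 / (4 * (K : ℝ) ^ 4) * x ^ 2) := by
        field_simp
      rw [h3]
      nlinarith
    have h1 := norm_lawVec_sub_sum v S _ hj t (Finset.univ \ S) Finset.sdiff_disjoint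
    have h2 : ∑ j ∈ Finset.univ \ S, (t j : ℝ) * v j = ∑ j, (t j : ℝ) * v j := by
      refine Finset.sum_subset (Finset.subset_univ _) fun j _ hj => ?_
      rw [ht j (by simpa using hj)]; simp
    rw [h2] at h1
    have h3 : ∑ j ∈ Finset.univ \ S, |(t j : ℝ)| ≤ (K : ℝ) ^ 2 := by
      have h4 : ((∑ j, |t j| : ℤ) : ℝ) ≤ ((K * K : ℤ) : ℝ) := by exact_mod_cast htK
      push_cast at h4
      rw [sq]
      exact (Finset.sum_le_sum_of_subset_of_nonneg (Finset.subset_univ _)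
        fun _ _ _ => abs_nonneg _).trans h4
    refine h1.trans ((mul_le_mul_of_nonneg_right h3 (by positivity)).trans_eq ?_)
    field_simp

/-- Elements of bounded order with few distinct short combinations have a small common order. -/
lemma exists_common_order {n K a M Q : ℕ} (hK : 2 ≤ K) {Γ : Type*} [AddCommGroup Γ]
    (w : Fin n → Γ) (S : Finset (Fin n)) (hM1 : 1 ≤ M) (hM : M < 2 ^ K)
    (hQ : Q ≤ K ^ a)
    (hw : ∀ j ∉ S, 0 < addOrderOf (w j) ∧ addOrderOf (w j) ≤ Q)
    (hcard : ∀ (X : Finset (Fin n → ℤ)) (D : ℕ), 1 ≤ D → D ≤ M ^ (a + 1) * Q →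
      (∀ t ∈ X, (∀ j ∈ S, t j = 0) ∧ (∀ j, 0 ≤ t j) ∧ ∑ j, t j ≤ K * K ∧
        D • ∑ j, t j • w j = 0) →
      Set.InjOn (fun t : Fin n → ℤ => ∑ j, t j • w j) X → X.card ≤ M) :
    ∃ D : ℕ, 1 ≤ D ∧ D ≤ M ^ (a + 1) ∧ ∀ j ∉ S, D • w j = 0 := by
  by_contra! hcon
  have key : ∀ l ≤ K, ∃ (X : Finset (Fin n → ℤ)) (D : ℕ), 1 ≤ D ∧ D ≤ X.card ^ (a + 1) ∧
      X.card ≤ M ∧ 2 ^ l ≤ X.card ∧ (∀ t ∈ X, (∀ j ∈ S, t j = 0) ∧ (∀ j, 0 ≤ t j) ∧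
        ∑ j, t j ≤ l * K ∧ D • ∑ j, t j • w j = 0) ∧
      Set.InjOn (fun t : Fin n → ℤ => ∑ j, t j • w j) X := by
    intro l
    induction l with
    | zero =>
      intro _
      refine ⟨{0}, 1, le_rfl, by simp, by simpa using hM1, by simp, ?_, by simp⟩
      intro t ht
      rw [Finset.mem_singleton] at ht
      subst ht
      simp
    | succ l ih =>
      intro hl
      obtain ⟨X, D, hD1, hD, hXM, hXl, hX, hinj⟩ := ih (by omega)
      obtain ⟨j, hj, hne⟩ := hcon D hD1 (hD.trans (Nat.pow_le_pow_left hXM _))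
      have hfin : 0 < addOrderOf (D • w j) := by
        rw [addOrderOf_pos_iff]
        exact (addOrderOf_pos_iff.mp (hw j hj).1).nsmul
      set q := addOrderOf (D • w j) with hq
      have hq2 : 2 ≤ q := by
        have : q ≠ 1 := fun h => hne (AddMonoid.addOrderOf_eq_one_iff.mp h)
        omega
      have hqQ : q ≤ Q := (Nat.le_of_dvd (hw j hj).1 (addOrderOf_smul_dvd D)).trans (hw j hj).2
      set r := min q K with hr
      have hr2 : 2 ≤ r := le_min hq2 hK
      have hqr : q ≤ r ^ (a + 1) := by
        rcases le_total q K with h | h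
        · rw [hr, min_eq_left h]
          exact Nat.le_self_pow (by omega) _
        · rw [hr, min_eq_right h]
          exact hqQ.trans (hQ.trans (Nat.pow_le_pow_right (by omega) (by omega)))
      let φ : (Fin n → ℤ) × ℕ → (Fin n → ℤ) := fun p => p.1 + Pi.single j (p.2 : ℤ)
      have hφ : ∀ p, ∑ i, φ p i • w i = ∑ i, p.1 i • w i + p.2 • w j := by
        intro p
        simp only [φ, Pi.add_apply, add_smul, Finset.sum_add_distrib]
        congr 1
        rw [Finset.sum_eq_single j]
        · simp
        · intro b _ hb
          simp [hb]
        · simp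
      have hinj' : Set.InjOn (fun p => ∑ i, φ p i • w i) (X ×ˢ Finset.range r : Finset _) := by
        rintro ⟨t, x⟩ htx ⟨t', x'⟩ htx' h
        simp only [Finset.coe_product, Set.mem_prod, Finset.mem_coe, Finset.mem_range] at htx htx'
        simp only [hφ] at h
        have h2 := congrArg (fun z => D • z) h
        simp only [smul_add, (hX t htx.1).2.2.2, (hX t' htx'.1).2.2.2, zero_add] at h2
        rw [smul_comm, smul_comm D] at h2
        have hxx : x = x' := nsmul_injOn_Iio_addOrderOf (x := D • w j)
          (by simp only [Set.mem_Iio]; omega) (by simp only [Set.mem_Iio]; omega) h2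
        subst hxx
        have := hinj htx.1 htx'.1 (add_right_cancel h)
        rw [this]
      have hcX : ((X ×ˢ Finset.range r).image φ).card = X.card * r := by
        rw [Finset.card_image_of_injOn, Finset.card_product, Finset.card_range]
        exact fun p hp p' hp' h => hinj' hp hp' (by simp only [h])
      have hprop : ∀ t ∈ (X ×ˢ Finset.range r).image φ, (∀ j ∈ S, t j = 0) ∧ (∀ j, 0 ≤ t j) ∧
          ∑ j, t j ≤ (l + 1 : ℕ) * K ∧ (D * q) • ∑ j, t j • w j = 0 := by
        intro t ht
        obtain ⟨⟨t', x⟩, hp, rfl⟩ := Finset.mem_image.mp ht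
        rw [Finset.mem_product, Finset.mem_range] at hp
        obtain ⟨h1, h2, h3, h4⟩ := hX t' hp.1
        refine ⟨fun i hi => ?_, fun i => ?_, ?_, ?_⟩
        · have : i ≠ j := fun h => hj (h ▸ hi)
          simp [φ, this, h1 i hi]
        · have := h2 i
          by_cases hij : i = j
          · subst hij; simp [φ]; omega
          · simp [φ, hij, this]
        · simp only [φ, Pi.add_apply, Finset.sum_add_distrib, Finset.sum_pi_single',
            Finset.mem_univ, if_true]
          have : x ≤ K := by omega
          push_cast
          have : (x : ℤ) ≤ K := by exact_mod_cast this
          linarith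
        · rw [hφ, smul_add, mul_comm, mul_smul, h4, smul_zero, zero_add, mul_smul, smul_comm D,
            smul_comm q, addOrderOf_nsmul_eq_zero, smul_zero]
      have hinj'' : Set.InjOn (fun t : Fin n → ℤ => ∑ j, t j • w j)
          ((X ×ˢ Finset.range r).image φ : Finset _) := by
        intro t ht t' ht' h
        obtain ⟨p, hp, rfl⟩ := Finset.mem_image.mp (Finset.mem_coe.mp ht)
        obtain ⟨p', hp', rfl⟩ := Finset.mem_image.mp (Finset.mem_coe.mp ht')
        rw [hinj' hp hp' h]
      refine ⟨(X ×ˢ Finset.range r).image φ, D * q, Nat.mul_pos hD1 (by omega), ?_, ?_, ?_,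
        hprop, hinj''⟩
      · rw [hcX, mul_pow]
        exact Nat.mul_le_mul hD hqr
      · refine hcard _ (D * q) (Nat.mul_pos hD1 (by omega))
          (Nat.mul_le_mul (hD.trans (Nat.pow_le_pow_left hXM _)) hqQ) (fun t ht => ?_) hinj''
        obtain ⟨h1, h2, h3, h4⟩ := hprop t ht
        refine ⟨h1, h2, h3.trans ?_, h4⟩
        exact_mod_cast Nat.mul_le_mul_right K hl
      · rw [hcX, pow_succ]
        exact Nat.mul_le_mul hXl hr2
  obtain ⟨X, D, -, -, hXM, hXl, -⟩ := key K le_rfl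
  omega

/-- The entries of `v` indexed by `T` satisfy no nontrivial integer relation with coefficients
bounded by `n ^ B`. -/
def IntIndep {n : ℕ} (B : ℕ) (v : Fin n → ℝ) (T : Finset (Fin n)) : Prop :=
  ∀ z : Fin n → ℤ, (∀ h ∉ T, z h = 0) → (∀ h, |z h| ≤ (n : ℤ) ^ B) → ∑ h, (z h : ℝ) * v h = 0 →
    z = 0

/-- The integer points of `ℚ ^ n`. -/
def intPoints (n : ℕ) : AddSubgroup (Fin n → ℚ) where
  carrier := {u | ∀ h, ∃ z : ℤ, u h = z}
  zero_mem' := fun _ => ⟨0, by simp⟩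
  add_mem' := by
    intro a b ha hb h
    obtain ⟨x, hx⟩ := ha h
    obtain ⟨y, hy⟩ := hb h
    exact ⟨x + y, by simp [hx, hy]⟩
  neg_mem' := by
    intro a ha h
    obtain ⟨x, hx⟩ := ha h
    exact ⟨-x, by simp [hx]⟩

lemma exists_common_denominator {n K a c b : ℕ} (hK : 2 ≤ K) (hn : 2 ≤ n) (hKn : K * K ≤ n)
    {v : Fin n → ℝ} {S T : Finset (Fin n)} {U : Finset ℝ} (hU : U.card ≤ n ^ c)
    (hcK : n ^ c < 2 ^ K) (hna : n ≤ K ^ a)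
    (hS : ∀ t : Fin n → ℤ, (∀ j ∈ S, t j = 0) → ∑ j, |t j| ≤ K * K → ∑ j, (t j : ℝ) * v j ∈ U)
    (hT : IntIndep (c * (a * b + 1) + 2 * b + 2) v T) (q : Fin n → ℕ) (p : Fin n → Fin n → ℤ)
    (hq : ∀ j ∉ S, 1 ≤ q j ∧ q j ≤ n ^ b) (hp : ∀ j ∉ S, ∀ h, |p j h| ≤ (n : ℤ) ^ b)
    (hpT : ∀ j ∉ S, ∀ h ∉ T, p j h = 0)
    (hv : ∀ j ∉ S, (q j : ℝ) * v j = ∑ h, (p j h : ℝ) * v h) :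
    ∃ D : ℕ, 1 ≤ D ∧ D ≤ n ^ (c * (a * b + 1)) ∧ ∀ j ∉ S, ∃ m : Fin n → ℤ,
      (∀ h, |m h| ≤ (n : ℤ) ^ (c * (a * b + 1) + b)) ∧ (∀ h ∉ T, m h = 0) ∧
      (D : ℝ) * v j = ∑ h, (m h : ℝ) * v h := by
  let u : Fin n → Fin n → ℚ := fun j h => (p j h : ℚ) / q j
  let w : Fin n → (Fin n → ℚ) ⧸ intPoints n := fun j => (u j : (Fin n → ℚ) ⧸ intPoints n)
  have hQ : n ^ b ≤ K ^ (a * b) := by rw [pow_mul]; exact Nat.pow_le_pow_left hna _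
  have hw : ∀ j ∉ S, 0 < addOrderOf (w j) ∧ addOrderOf (w j) ≤ n ^ b := by
    intro j hj
    have h0 : q j • w j = 0 := by
      simp only [w]
      rw [← QuotientAddGroup.mk_nsmul, QuotientAddGroup.eq_zero_iff]
      intro h
      refine ⟨p j h, ?_⟩
      have : (q j : ℚ) ≠ 0 := by have := (hq j hj).1; positivity
      simp only [u, Pi.smul_apply, nsmul_eq_mul]
      field_simp
    have hq0 : 0 < q j := (hq j hj).1
    exact ⟨addOrderOf_pos_iff.mpr (isOfFinAddOrder_iff_nsmul_eq_zero.mpr ⟨_, hq0, h0⟩),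
      (addOrderOf_le_of_nsmul_eq_zero hq0 h0).trans (hq j hj).2⟩
  have hsum : ∀ t : Fin n → ℤ, ∑ j, t j • w j =
      ((∑ j, t j • u j : Fin n → ℚ) : (Fin n → ℚ) ⧸ intPoints n) := by
    intro t
    simp only [w, ← QuotientAddGroup.mk_zsmul]
    exact (map_sum (QuotientAddGroup.mk' (intPoints n)) _ _).symm
  have hu : ∀ j ∉ S, ∀ h, |u j h| ≤ (n : ℚ) ^ b := by
    intro j hj h
    have h1 : (1 : ℚ) ≤ q j := by exact_mod_cast (hq j hj).1
    simp only [u, abs_div, Nat.abs_cast]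
    rw [div_le_iff₀ (by positivity)]
    have h2 : |(p j h : ℚ)| ≤ (n : ℚ) ^ b := by exact_mod_cast hp j hj h
    nlinarith [abs_nonneg (p j h : ℚ)]
  have huv : ∀ j ∉ S, ∑ h, ((u j h : ℚ) : ℝ) * v h = v j := by
    intro j hj
    have h1 : (q j : ℝ) ≠ 0 := by
      have := (hq j hj).1
      positivity
    have h2 := hv j hj
    rw [mul_comm, ← eq_div_iff h1] at h2
    rw [h2, Finset.sum_div]
    refine Finset.sum_congr rfl fun h _ => ?_
    simp only [u]
    push_cast
    ring
  have huT : ∀ j ∉ S, ∀ h ∉ T, u j h = 0 := by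
    intro j hj h hh
    simp [u, hpT j hj h hh]
  obtain ⟨D, hD1, hD, hDw⟩ := exists_common_order (M := n ^ c) (Q := n ^ b) (a := a * b) hK w S
    (Nat.one_le_pow _ _ (by omega)) hcK hQ hw (by
      intro X D hD1 hD hX hinj
      refine le_trans ?_ hU
      refine Finset.card_le_card_of_injOn (fun t => ∑ j, (t j : ℝ) * v j) ?_ ?_
      · intro t ht
        obtain ⟨h1, h2, h3, -⟩ := hX t ht
        refine hS t h1 ?_
        simp only [fun j => abs_of_nonneg (h2 j), h3]
      · intro t ht t' ht' heq
        obtain ⟨h1, h2, h3, h4⟩ := hX t ht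
        obtain ⟨h1', h2', h3', h4'⟩ := hX t' ht'
        refine hinj ht ht' ?_
        have hint : ∀ h, ∃ z : ℤ, (D : ℚ) * ∑ j, ((t j - t' j : ℤ) : ℚ) * u j h = z := by
          have h5 : D • ((∑ j, t j • u j - ∑ j, t' j • u j : Fin n → ℚ) :
              (Fin n → ℚ) ⧸ intPoints n) = 0 := by
            rw [QuotientAddGroup.mk_sub, ← hsum, ← hsum, nsmul_sub, h4, h4', sub_zero]
          rw [← QuotientAddGroup.mk_nsmul, QuotientAddGroup.eq_zero_iff] at h5
          intro h
          obtain ⟨z, hz⟩ := h5 h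
          refine ⟨z, ?_⟩
          rw [← hz]
          simp only [Pi.smul_apply, Pi.sub_apply, Finset.sum_apply]
          simp only [nsmul_eq_mul, zsmul_eq_mul, ← Finset.sum_sub_distrib, Int.cast_sub, sub_mul]
        choose z hz using hint
        have hzero : ∀ j ∈ S, t j - t' j = 0 := fun j hj => by rw [h1 j hj, h1' j hj, sub_zero]
        have hz0 : z = 0 := by
          refine hT z (fun h hh => ?_) (fun h => ?_) ?_
          · have h5 : ∑ j, ((t j - t' j : ℤ) : ℚ) * u j h = 0 := by
              refine Finset.sum_eq_zero fun j _ => ?_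
              by_cases hj : j ∈ S
              · rw [hzero j hj]; simp
              · rw [huT j hj h hh, mul_zero]
            have h6 := hz h
            rw [h5, mul_zero] at h6
            exact_mod_cast h6.symm
          · have h5 : |∑ j, ((t j - t' j : ℤ) : ℚ) * u j h| ≤ (2 * n : ℚ) * (n : ℚ) ^ b := by
              calc _ ≤ ∑ j, |((t j - t' j : ℤ) : ℚ) * u j h| := Finset.abs_sum_le_sum_abs _ _
                _ ≤ ∑ j, ((t j + t' j : ℤ) : ℚ) * (n : ℚ) ^ b := by
                    refine Finset.sum_le_sum fun j _ => ?_
                    rw [abs_mul]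
                    by_cases hj : j ∈ S
                    · rw [hzero j hj, h1 j hj, h1' j hj]; simp
                    · have h6 : |((t j - t' j : ℤ) : ℚ)| ≤ ((t j + t' j : ℤ) : ℚ) := by
                        rw [← Int.cast_abs, Int.cast_le, abs_le]
                        have := h2 j
                        have := h2' j
                        omega
                      exact mul_le_mul h6 (hu j hj h) (abs_nonneg _)
                        ((abs_nonneg _).trans h6)
                _ = ((∑ j, t j + ∑ j, t' j : ℤ) : ℚ) * (n : ℚ) ^ b := by
                    rw [← Finset.sum_mul]
                    push_cast
                    rw [Finset.sum_add_distrib]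
                _ ≤ _ := by
                    gcongr
                    have h6 : (K : ℤ) * K ≤ n := by exact_mod_cast hKn
                    exact_mod_cast (by linarith : ∑ j, t j + ∑ j, t' j ≤ 2 * (n : ℤ))
            have h7 : |(z h : ℚ)| ≤ (n : ℚ) ^ (c * (a * b + 1) + 2 * b + 2) := by
              rw [← hz h, abs_mul, Nat.abs_cast]
              have h8 : (D : ℚ) ≤ (n : ℚ) ^ (c * (a * b + 1)) * (n : ℚ) ^ b := by
                rw [pow_mul]
                exact_mod_cast hD
              have h9 : (2 : ℚ) ≤ n := by exact_mod_cast hn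
              calc _ ≤ ((n : ℚ) ^ (c * (a * b + 1)) * (n : ℚ) ^ b) * (2 * n * (n : ℚ) ^ b) := by
                    gcongr
                _ ≤ ((n : ℚ) ^ (c * (a * b + 1)) * (n : ℚ) ^ b) * (n * n * (n : ℚ) ^ b) := by
                    gcongr
                _ = _ := by ring
            exact_mod_cast h7
          · have hzr : ∀ h, (z h : ℝ) =
                (D : ℝ) * ∑ j, ((t j - t' j : ℤ) : ℝ) * ((u j h : ℚ) : ℝ) := by
              intro h
              have := congrArg (fun x : ℚ => (x : ℝ)) (hz h)
              push_cast at this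
              push_cast
              exact this.symm
            calc ∑ h, (z h : ℝ) * v h
                = (D : ℝ) * ∑ j, ((t j - t' j : ℤ) : ℝ) * ∑ h, ((u j h : ℚ) : ℝ) * v h := by
                  simp only [hzr, Finset.mul_sum, Finset.sum_mul]
                  rw [Finset.sum_comm]
                  exact Finset.sum_congr rfl fun _ _ => Finset.sum_congr rfl fun _ _ => by ring
              _ = (D : ℝ) * ∑ j, ((t j - t' j : ℤ) : ℝ) * v j := by
                  congr 1
                  refine Finset.sum_congr rfl fun j _ => ?_
                  by_cases hj : j ∈ S
                  · rw [hzero j hj]; simp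
                  · rw [huv j hj]
              _ = 0 := by
                  simp only at heq
                  push_cast
                  simp only [sub_mul, Finset.sum_sub_distrib, heq, sub_self, mul_zero]
        simp only [hsum]
        congr 1
        funext h
        have h5 := hz h
        rw [hz0] at h5
        have hD0 : (D : ℚ) ≠ 0 := by positivity
        simp only [Pi.zero_apply, Int.cast_zero, mul_eq_zero, hD0, false_or] at h5
        simp only [Finset.sum_apply, Pi.smul_apply]
        simp only [zsmul_eq_mul]
        push_cast at h5
        simp only [sub_mul, Finset.sum_sub_distrib] at h5
        linarith)
  refine ⟨D, hD1, by rwa [pow_mul], fun j hj => ?_⟩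
  have h1 := hDw j hj
  simp only [w] at h1
  rw [← QuotientAddGroup.mk_nsmul, QuotientAddGroup.eq_zero_iff] at h1
  choose m hm using h1
  simp only [Pi.smul_apply, nsmul_eq_mul] at hm
  refine ⟨m, fun h => ?_, fun h hh => ?_, ?_⟩
  · have h7 : |(m h : ℚ)| ≤ (n : ℚ) ^ (c * (a * b + 1) + b) := by
      rw [← hm h, abs_mul, Nat.abs_cast, pow_add, pow_mul]
      gcongr
      · exact_mod_cast hD
      · exact hu j hj h
    exact_mod_cast h7
  · have := hm h
    rw [huT j hj h hh, mul_zero] at this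
    exact_mod_cast this.symm
  · rw [← huv j hj, Finset.mul_sum]
    refine Finset.sum_congr rfl fun h _ => ?_
    have := congrArg (fun x : ℚ => (x : ℝ)) (hm h)
    push_cast at this
    rw [← this]
    ring

/-- A rapidly growing sequence of exponents. -/
def growthSeq (a c : ℕ) : ℕ → ℕ
  | 0 => 1
  | i + 1 => c * (a * growthSeq a c i + 1) + 2 * growthSeq a c i + 2

lemma growthSeq_mono (a c : ℕ) : Monotone (growthSeq a c) := by
  refine monotone_nat_of_le_succ fun i => ?_
  rw [growthSeq]
  omega

lemma IntIndep.card_le {n K B d c : ℕ} {v : Fin n → ℝ} {S T : Finset (Fin n)} {U : Finset ℝ}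
    (hU : U.card ≤ n ^ c) (hKn : K ≤ n) (hB : 1 ≤ B) (hTd : T.card = d)
    (hdK : d ≤ K) (hTS : Disjoint T S)
    (hS : ∀ t : Fin n → ℤ, (∀ j ∈ S, t j = 0) → ∑ j, |t j| ≤ K * K → ∑ j, (t j : ℝ) * v j ∈ U)
    (hT : IntIndep B v T) : K ^ d ≤ n ^ c := by
  let ext : (T → Fin K) → Fin n → ℤ := fun t j => if h : j ∈ T then ((t ⟨j, h⟩ : ℕ) : ℤ) else 0
  have h1 : Fintype.card (T → Fin K) = K ^ d := by simp [hTd]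
  rw [← h1, ← Finset.card_univ]
  refine le_trans ?_ hU
  refine Finset.card_le_card_of_injOn (fun t => ∑ j, (ext t j : ℝ) * v j) ?_ ?_
  · intro t _
    refine hS _ (fun j hj => ?_) ?_
    · have : j ∉ T := fun h => Finset.disjoint_left.mp hTS h hj
      simp [ext, this]
    · calc ∑ j, |ext t j| ≤ ∑ j, if j ∈ T then (K : ℤ) else 0 := by
            refine Finset.sum_le_sum fun j _ => ?_
            by_cases h : j ∈ T
            · have := (t ⟨j, h⟩).isLt
              simp only [ext, h, dif_pos, if_true]
              rw [abs_of_nonneg (by positivity)]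
              exact_mod_cast this.le
            · simp [ext, h]
        _ = d * K := by simp [hTd]
        _ ≤ K * K := by gcongr
  · intro t _ t' _ h
    have h2 : (fun j => ext t j - ext t' j) = 0 := by
      refine hT _ (fun j hj => by simp [ext, hj]) (fun j => ?_) ?_
      · have h3 : |ext t j - ext t' j| ≤ (n : ℤ) := by
          by_cases hj : j ∈ T
          · have h4 := (t ⟨j, hj⟩).isLt
            have h5 := (t' ⟨j, hj⟩).isLt
            simp only [ext, hj, dif_pos]
            rw [abs_le]
            omega
          · simp [ext, hj]
        have hn : 1 ≤ n := Fin.pos j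
        refine h3.trans ?_
        exact_mod_cast Nat.le_self_pow (by omega) n
      · simp only at h
        push_cast
        simp only [sub_mul, Finset.sum_sub_distrib, h, sub_self]
    funext ⟨j, hj⟩
    have h3 := congrFun h2 j
    simp only [ext, hj, dif_pos, Pi.zero_apply] at h3
    exact Fin.ext (by omega)

lemma exists_structure_of_short_combinations (a c : ℕ) : ∃ e : ℕ, ∀ (n K : ℕ) (v : Fin n → ℝ)
    (S : Finset (Fin n)) (U : Finset ℝ), 2 ≤ K → 2 ≤ n → K * K ≤ n → U.card ≤ n ^ c →
    n ^ c < 2 ^ K → n ≤ K ^ a → a * c + 1 ≤ K →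
    (∀ t : Fin n → ℤ, (∀ j ∈ S, t j = 0) → ∑ j, |t j| ≤ K * K → ∑ j, (t j : ℝ) * v j ∈ U) →
    ∃ (T : Finset (Fin n)) (D : ℕ), T.card ≤ a * c ∧ 1 ≤ D ∧ D ≤ n ^ e ∧ ∀ j ∉ S,
      ∃ m : Fin n → ℤ, (∀ h, |m h| ≤ (n : ℤ) ^ e) ∧ (∀ h ∉ T, m h = 0) ∧
        (D : ℝ) * v j = ∑ h, (m h : ℝ) * v h := by
  set d := a * c with hd
  refine ⟨c * (a * growthSeq a c d + 1) + growthSeq a c d, ?_⟩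
  intro n K v S U hK hn hKn hU hcK hna hdK hS
  let P : ℕ → Prop := fun k => ∃ T : Finset (Fin n), T.card = k ∧ Disjoint T S ∧
    IntIndep (growthSeq a c (d + 1 - k)) v T
  have hP0 : P 0 := ⟨∅, rfl, Finset.disjoint_empty_left _, fun z hz _ _ =>
    funext fun h => hz h (Finset.notMem_empty h)⟩
  have hPd : ¬ P (d + 1) := by
    rintro ⟨T, hT, hTS, hTI⟩
    have hB : 1 ≤ growthSeq a c (d + 1 - (d + 1)) := growthSeq_mono a c (Nat.zero_le _)
    have h1 := hTI.card_le hU (by nlinarith) hB hT hdK hTS hS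
    have h2 : n ^ c ≤ K ^ d := by rw [hd, pow_mul]; exact Nat.pow_le_pow_left hna c
    have h3 : K ^ d < K ^ (d + 1) := Nat.pow_lt_pow_right (by omega) (by omega)
    omega
  have hex : ∃ k ≤ d, P k ∧ ¬ P (k + 1) := by
    by_contra! hcon
    have : ∀ k ≤ d + 1, P k := by
      intro k
      induction k with
      | zero => exact fun _ => hP0
      | succ k ih => exact fun hk => hcon k (by omega) (ih (by omega))
    exact hPd (this _ le_rfl)
  obtain ⟨k, hkd, ⟨T, hTk, hTS, hTI⟩, hPk⟩ := hex
  obtain ⟨i, hi⟩ : ∃ i, d - k = i := ⟨_, rfl⟩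
  rw [show d + 1 - k = i + 1 by omega, growthSeq] at hTI
  set b := growthSeq a c i with hb
  have hbd : b ≤ growthSeq a c d := growthSeq_mono a c (by omega)
  have hqp : ∀ j, ∃ (q : ℕ) (p : Fin n → ℤ), j ∉ S → (1 ≤ q ∧ q ≤ n ^ b) ∧
      (∀ h, |p h| ≤ (n : ℤ) ^ b) ∧ (∀ h ∉ T, p h = 0) ∧
      (q : ℝ) * v j = ∑ h, (p h : ℝ) * v h := by
    intro j
    by_cases hjS : j ∈ S
    · exact ⟨0, 0, fun h => absurd hjS h⟩
    by_cases hjT : j ∈ T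
    · refine ⟨1, Pi.single j 1, fun _ => ⟨⟨le_rfl, Nat.one_le_pow _ _ (by omega)⟩, fun h => ?_,
        fun h hh => ?_, ?_⟩⟩
      · have := one_le_int_pow hn b
        by_cases hjh : h = j
        · subst hjh; simpa using this
        · simp [hjh]
      · have : h ≠ j := fun h' => hh (h' ▸ hjT)
        simp [this]
      · rw [Finset.sum_eq_single j]
        · simp
        · intro h _ hh; simp [hh]
        · simp
    · have hno : ¬ IntIndep b v (insert j T) := by
        intro h
        refine hPk ⟨insert j T, by rw [Finset.card_insert_of_notMem hjT, hTk], ?_, ?_⟩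
        · rw [Finset.disjoint_insert_left]; exact ⟨hjS, hTS⟩
        · rwa [show d + 1 - (k + 1) = i by omega]
      unfold IntIndep at hno
      push Not at hno
      obtain ⟨z, hz1, hz2, hz3, hz4⟩ := hno
      have hzj : z j ≠ 0 := by
        intro h0
        refine hz4 (hTI z (fun h hh => ?_) (fun h => (hz2 h).trans (int_pow_le_pow hn (by omega)))
          hz3)
        by_cases hhj : h = j
        · rw [hhj, h0]
        · exact hz1 h (by simp [hhj, hh])
      have hz5 : (z j : ℝ) * v j = ∑ h, ((if h = j then 0 else - z h : ℤ) : ℝ) * v h := by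
        rw [← Finset.add_sum_erase _ _ (Finset.mem_univ j)] at hz3
        rw [← Finset.add_sum_erase Finset.univ (fun h => ((if h = j then 0 else - z h : ℤ) : ℝ) * v h)
          (Finset.mem_univ j), eq_neg_of_add_eq_zero_left hz3]
        simp only [if_true, Int.cast_zero, zero_mul, zero_add, ← Finset.sum_neg_distrib]
        refine Finset.sum_congr rfl fun h hh => ?_
        rw [if_neg (Finset.ne_of_mem_erase hh)]
        push_cast; ring
      refine ⟨(z j).natAbs, fun h => (z j).sign * (if h = j then 0 else - z h), fun _ =>
        ⟨⟨Int.natAbs_pos.mpr hzj, ?_⟩, fun h => ?_, fun h hh => ?_, ?_⟩⟩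
      · have := hz2 j
        rw [Int.abs_eq_natAbs] at this
        exact_mod_cast this
      · rw [abs_mul, Int.abs_sign_of_ne_zero hzj, one_mul]
        split_ifs
        · simp
        · rw [abs_neg]; exact hz2 h
      · by_cases hhj : h = j
        · simp [hhj]
        · dsimp only
          rw [if_neg hhj, hz1 h (by simp [hhj, hh])]; simp
      · have h1 : (((z j).natAbs : ℕ) : ℝ) = ((z j).sign : ℝ) * (z j : ℝ) := by
          have := Int.sign_mul_self_eq_natAbs (z j)
          rw [Nat.cast_natAbs]
          exact_mod_cast this.symm
        rw [h1, mul_assoc, hz5, Finset.mul_sum]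
        refine Finset.sum_congr rfl fun h _ => ?_
        push_cast; ring
  choose q p hqp using hqp
  obtain ⟨D, hD1, hD, hDm⟩ := exists_common_denominator hK hn hKn hU hcK hna hS hTI q p
    (fun j hj => (hqp j hj).1) (fun j hj => (hqp j hj).2.1) (fun j hj => (hqp j hj).2.2.1)
    (fun j hj => (hqp j hj).2.2.2)
  have hle : c * (a * b + 1) + b ≤ c * (a * growthSeq a c d + 1) + growthSeq a c d := by gcongr
  refine ⟨T, D, by omega, hD1, hD.trans (Nat.pow_le_pow_right (by omega) (by omega)),
    fun j hj => ?_⟩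
  obtain ⟨m, hm1, hm2, hm3⟩ := hDm j hj
  exact ⟨m, fun h => (hm1 h).trans (int_pow_le_pow hn hle), hm2, hm3⟩

open Filter in
lemma eventually_le_natCast_rpow (b : ℝ) {δ : ℝ} (hδ : 0 < δ) :
    ∀ᶠ n : ℕ in atTop, b ≤ (n : ℝ) ^ δ :=
  ((tendsto_rpow_atTop hδ).comp tendsto_natCast_atTop_atTop).eventually_ge_atTop b

open Filter in
lemma eventually_rpow_lt_exp (s : ℝ) {δ b : ℝ} (hδ : 0 < δ) (hb : 0 < b) :
    ∀ᶠ n : ℕ in atTop, (n : ℝ) ^ s < Real.exp (b * (n : ℝ) ^ δ) := by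
  have h1 := (isLittleO_rpow_exp_pos_mul_atTop (s / δ) hb).bound (by norm_num : (0 : ℝ) < 1 / 2)
  have h2 := ((tendsto_rpow_atTop hδ).comp tendsto_natCast_atTop_atTop).eventually h1
  filter_upwards [h2] with n hn
  simp only [Function.comp] at hn
  rw [← Real.rpow_mul (Nat.cast_nonneg n), mul_div_cancel₀ s hδ.ne', Real.norm_eq_abs,
    Real.norm_eq_abs, abs_of_pos (Real.exp_pos _),
    abs_of_nonneg (Real.rpow_nonneg (Nat.cast_nonneg n) s)] at hn
  linarith [Real.exp_pos (b * (n : ℝ) ^ δ)]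

set_option maxHeartbeats 1000000 in
open Filter in
/-- A weak inverse Littlewood-Offord theorem for linear forms. -/
lemma linear_inverse_LO {ε : ℝ} (hε : 0 < ε) (c : ℕ) : ∃ r e : ℕ, ∀ᶠ n : ℕ in atTop,
    ∀ (v : Fin n → ℝ) (a : ℝ), (2 : ℝ) ^ n ≤ (n : ℝ) ^ c *
      ((Finset.univ.filter fun y : Fin n → Bool => ∑ j, v j * signv (y j) = a).card : ℝ) →
    ∃ (T : Finset (Fin n)) (D : ℕ) (E : Finset (Fin n)), T.card ≤ r ∧ 1 ≤ D ∧ D ≤ n ^ e ∧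
      (E.card : ℝ) ≤ (n : ℝ) ^ ε ∧ ∀ j ∉ E, ∃ m : Fin n → ℤ, (∀ h, |m h| ≤ (n : ℤ) ^ e) ∧
        (∀ h ∉ T, m h = 0) ∧ (D : ℝ) * v j = ∑ h, (m h : ℝ) * v h := by
  set ε' := min ε 1 with hε'
  have hε'0 : 0 < ε' := lt_min hε one_pos
  have hε'1 : ε' ≤ 1 := min_le_right _ _
  set δ := ε' / 8 with hδ
  have hδ0 : 0 < δ := by positivity
  set g := ⌈2 / δ⌉₊ with hg
  obtain ⟨e, he⟩ := exists_structure_of_short_combinations g (2 * c + 1)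
  refine ⟨g * (2 * c + 1), e, ?_⟩
  filter_upwards [eventually_ge_atTop 2, eventually_le_natCast_rpow (g * (2 * c + 1) + 4) hδ0,
    eventually_le_natCast_rpow 2 hε'0, eventually_le_natCast_rpow 2 (half_pos hδ0),
    eventually_rpow_lt_exp (2 * c : ℕ) (half_pos hε'0) (by norm_num : (0 : ℝ) < 1 / 8),
    eventually_rpow_lt_exp (2 * c + 1 : ℕ) hδ0 (by norm_num : (0 : ℝ) < 1 / 4)]
    with n hn hx1 hx2 hx3 hx4 hx5 v a hva
  set N := ((Finset.univ.filter fun y : Fin n → Bool => ∑ j, v j * signv (y j) = a).card : ℝ)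
    with hN
  set x := (n : ℝ) ^ δ with hx
  have hn1 : (1 : ℝ) ≤ n := by exact_mod_cast (by omega : 1 ≤ n)
  have hn0 : (0 : ℝ) ≤ n := by linarith
  set K := ⌊x⌋₊ with hK
  have hx0 : 0 ≤ x := Real.rpow_nonneg hn0 _
  have hKx : (K : ℝ) ≤ x := Nat.floor_le hx0
  have hxK : x < K + 1 := Nat.lt_floor_add_one x
  have hgc : (0 : ℝ) ≤ g * (2 * c + 1) := by positivity
  have hK3 : (3 : ℝ) ≤ K := by linarith
  have hK2 : 2 ≤ K := by exact_mod_cast (by linarith : (2 : ℝ) ≤ K)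
  set m := ⌊(n : ℝ) ^ ε'⌋₊ with hm
  have hmle : (m : ℝ) ≤ (n : ℝ) ^ ε' := Nat.floor_le (Real.rpow_nonneg hn0 _)
  have hmge : (n : ℝ) ^ ε' / 2 ≤ m := by
    have := Nat.lt_floor_add_one ((n : ℝ) ^ ε')
    linarith
  have hx4e : x ^ 4 = (n : ℝ) ^ (ε' / 2) := by
    rw [hx, ← Real.rpow_natCast, ← Real.rpow_mul hn0]
    congr 1
    rw [hδ]; push_cast; ring
  have hee : (n : ℝ) ^ ε' = (n : ℝ) ^ (ε' / 2) * (n : ℝ) ^ (ε' / 2) := by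
    rw [← Real.rpow_add (by linarith)]; congr 1; ring
  have hK4 : (K : ℝ) ^ 4 ≤ (n : ℝ) ^ (ε' / 2) := by rw [← hx4e]; gcongr
  have hN0 : 0 ≤ N := Nat.cast_nonneg _
  have h4 : (4 : ℝ) ^ n ≤ (n : ℝ) ^ (2 * c) * N ^ 2 := by
    have := mul_self_le_mul_self (by positivity) hva
    rw [← mul_pow] at this
    norm_num at this
    calc _ ≤ _ := this
      _ = _ := by ring
  have hNpos : 0 < N := by
    rcases hN0.lt_or_eq with h | h
    · exact h
    · rw [← h] at hva
      have : (0 : ℝ) < 2 ^ n := by positivity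
      linarith
  have hbase : 0 ≤ 1 - 1 / (4 * (K : ℝ) ^ 4) := by
    rw [sub_nonneg, div_le_one (by positivity)]
    nlinarith [one_le_pow₀ (by linarith : (1 : ℝ) ≤ K) (n := 4)]
  have hdec : (1 - 1 / (4 * (K : ℝ) ^ 4)) ^ m * 4 ^ n < N ^ 2 := by
    have h5 : (1 - 1 / (4 * (K : ℝ) ^ 4)) ^ m ≤ Real.exp (-(1 / 8 * (n : ℝ) ^ (ε' / 2))) := by
      calc _ ≤ (Real.exp (-(1 / (4 * (K : ℝ) ^ 4)))) ^ m := by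
            gcongr
            exact Real.one_sub_le_exp_neg _
        _ = Real.exp (m * -(1 / (4 * (K : ℝ) ^ 4))) := by rw [← Real.exp_nat_mul]
        _ ≤ _ := by
            gcongr
            rw [mul_neg, neg_le_neg_iff, mul_one_div, le_div_iff₀ (by positivity)]
            have h6 : 0 ≤ (n : ℝ) ^ (ε' / 2) := Real.rpow_nonneg hn0 _
            calc _ ≤ 1 / 8 * (n : ℝ) ^ (ε' / 2) * (4 * (n : ℝ) ^ (ε' / 2)) := by gcongr
              _ = (n : ℝ) ^ ε' / 2 := by rw [hee]; ring
              _ ≤ m := hmge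
    rw [Real.rpow_natCast] at hx4
    calc _ ≤ Real.exp (-(1 / 8 * (n : ℝ) ^ (ε' / 2))) * ((n : ℝ) ^ (2 * c) * N ^ 2) := by
          gcongr
      _ < Real.exp (-(1 / 8 * (n : ℝ) ^ (ε' / 2))) *
          (Real.exp (1 / 8 * (n : ℝ) ^ (ε' / 2)) * N ^ 2) := by gcongr
      _ = N ^ 2 := by rw [← mul_assoc, ← Real.exp_add]; simp
  obtain ⟨S, hSm, U, hU, hS⟩ := exists_finset_short_combinations (by omega) v a hdec
  have hUn : U.card ≤ n ^ (2 * c + 1) := by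
    have h5 : (U.card : ℝ) * N ^ 2 ≤ (2 * (n : ℝ) ^ (2 * c)) * N ^ 2 := by
      calc _ ≤ _ := hU
        _ ≤ 2 * ((n : ℝ) ^ (2 * c) * N ^ 2) := by gcongr
        _ = _ := by ring
    have h6 := le_of_mul_le_mul_right h5 (by positivity)
    have h7 : (U.card : ℝ) ≤ (n : ℝ) ^ (2 * c + 1) := by
      refine h6.trans ?_
      rw [pow_succ']
      gcongr
      exact_mod_cast hn
    exact_mod_cast h7
  have hKn : K * K ≤ n := by
    have h5 : (K : ℝ) * K ≤ n := by
      calc (K : ℝ) * K ≤ x * x := by gcongr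
        _ = (n : ℝ) ^ (δ + δ) := by rw [hx, ← Real.rpow_add (by linarith)]
        _ ≤ (n : ℝ) ^ (1 : ℝ) := by
            apply Real.rpow_le_rpow_of_exponent_le hn1
            rw [hδ]; linarith
        _ = n := Real.rpow_one _
    exact_mod_cast h5
  have hcK : n ^ (2 * c + 1) < 2 ^ K := by
    have h5 : (n : ℝ) ^ (2 * c + 1) < 2 ^ K := by
      rw [Real.rpow_natCast] at hx5
      refine hx5.trans_le ?_
      rw [← Real.rpow_natCast 2 K, Real.rpow_def_of_pos two_pos]
      refine Real.exp_le_exp.mpr ?_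
      have h6 := Real.log_two_gt_d9
      have h7 : 1 / 2 * (K : ℝ) ≤ Real.log 2 * K := by gcongr; linarith
      linarith
    exact_mod_cast h5
  have hna : n ≤ K ^ g := by
    have h5 : (n : ℝ) ≤ (K : ℝ) ^ g := by
      have h6 : (n : ℝ) ^ (δ / 2) ≤ K := by
        have h7 : x = (n : ℝ) ^ (δ / 2) * (n : ℝ) ^ (δ / 2) := by
          rw [← Real.rpow_add (by linarith), add_halves]
        have h8 : (n : ℝ) ^ (δ / 2) + 1 ≤ (n : ℝ) ^ (δ / 2) * (n : ℝ) ^ (δ / 2) := by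
          nlinarith only [hx3]
        linarith
      calc (n : ℝ) = (n : ℝ) ^ (1 : ℝ) := (Real.rpow_one _).symm
        _ ≤ (n : ℝ) ^ (δ / 2 * g) := by
            apply Real.rpow_le_rpow_of_exponent_le hn1
            have h7 : 2 / δ ≤ g := Nat.le_ceil _
            rw [div_le_iff₀ hδ0] at h7
            linarith
        _ = ((n : ℝ) ^ (δ / 2)) ^ g := by rw [Real.rpow_mul hn0, Real.rpow_natCast]
        _ ≤ _ := by gcongr
    exact_mod_cast h5
  have hgK : g * (2 * c + 1) + 1 ≤ K := by
    have : (g : ℝ) * (2 * c + 1) + 1 ≤ K := by linarith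
    exact_mod_cast this
  obtain ⟨T, D, hT, hD1, hD, hm⟩ := he n K v S U hK2 hn hKn hUn hcK hna hgK hS
  refine ⟨T, D, S, hT, hD1, hD, ?_, hm⟩
  calc (S.card : ℝ) ≤ m := by exact_mod_cast hSm
    _ ≤ (n : ℝ) ^ ε' := hmle
    _ ≤ (n : ℝ) ^ ε := Real.rpow_le_rpow_of_exponent_le hn1 (min_le_left _ _)

lemma card_filter_card_le (n r : ℕ) :
    (Finset.univ.filter fun T : Finset (Fin n) => T.card ≤ r).card ≤ (n + 1) ^ r := by
  induction r with
  | zero =>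
    rw [pow_zero, Finset.card_le_one]
    intro a ha b hb
    simp only [Finset.mem_filter, Nat.le_zero, Finset.card_eq_zero] at ha hb
    rw [ha.2, hb.2]
  | succ r ih =>
    let s := Finset.univ.filter fun T : Finset (Fin n) => T.card ≤ r
    let φ : Finset (Fin n) × Option (Fin n) → Finset (Fin n) :=
      fun p => p.2.elim p.1 fun i => insert i p.1
    have hsub : (Finset.univ.filter fun T : Finset (Fin n) => T.card ≤ r + 1) ⊆
        (s ×ˢ Finset.univ).image φ := by
      intro T hT
      simp only [Finset.mem_filter, Finset.mem_univ, true_and] at hT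
      rw [Finset.mem_image]
      rcases T.eq_empty_or_nonempty with rfl | ⟨i, hi⟩
      · exact ⟨(∅, none), by simp [s], rfl⟩
      · refine ⟨(T.erase i, some i), ?_, Finset.insert_erase hi⟩
        simp only [s, Finset.mem_product, Finset.mem_filter, Finset.mem_univ, true_and, and_true]
        rw [Finset.card_erase_of_mem hi]
        omega
    calc _ ≤ _ := Finset.card_le_card hsub
      _ ≤ (s ×ˢ (Finset.univ : Finset (Option (Fin n)))).card := Finset.card_image_le
      _ = s.card * (n + 1) := by simp [Finset.card_product]
      _ ≤ _ := by rw [pow_succ]; exact Nat.mul_le_mul_right _ ih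

lemma exists_popular_fiber {α β : Type*} [DecidableEq β] {n a b : ℕ} {X : ℝ} (hX : 0 < X) (s : Finset α)
    (t : Finset β) (f : α → β) (hf : ∀ x ∈ s, f x ∈ t) (ht : t.card ≤ n ^ b)
    (hs : X ≤ (n : ℝ) ^ a * s.card) :
    ∃ y ∈ t, X ≤ (n : ℝ) ^ (a + b) * (s.filter fun x => f x = y).card := by
  have hs0 : 0 < s.card := by
    by_contra h0
    have : s.card = 0 := by omega
    rw [this] at hs
    simp at hs
    linarith
  have hne : t.Nonempty := by
    obtain ⟨x, hx⟩ := Finset.card_pos.mp hs0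
    exact ⟨f x, hf x hx⟩
  have ht0 : (0 : ℝ) < t.card := by exact_mod_cast hne.card_pos
  obtain ⟨y, hy, hy'⟩ := Finset.exists_le_card_fiber_of_nsmul_le_card_of_maps_to (M := ℝ) hf hne
    (b := (s.card : ℝ) / t.card) (by rw [nsmul_eq_mul, mul_div_cancel₀ _ ht0.ne'])
  refine ⟨y, hy, hs.trans ?_⟩
  rw [div_le_iff₀ ht0] at hy'
  rw [pow_add, mul_assoc]
  gcongr
  have : (t.card : ℝ) ≤ (n : ℝ) ^ b := by exact_mod_cast ht
  calc (s.card : ℝ) ≤ _ := hy'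
    _ = (t.card : ℝ) * _ := mul_comm _ _
    _ ≤ _ := by gcongr

/-- The bilinear form evaluated at sign vectors. -/
lemma sum_bilinear_eq {n : ℕ} (A : Matrix (Fin n) (Fin n) ℝ) (x y : Fin n → Bool) :
    ∑ i, ∑ j, A i j * signv (x i) * signv (y j) =
      ∑ i, (∑ j, A i j * signv (y j)) * signv (x i) := by
  refine Finset.sum_congr rfl fun i _ => ?_
  rw [Finset.sum_mul]
  exact Finset.sum_congr rfl fun j _ => by ring

/-- Many `y` for which the linear form in `x` concentrates. -/
lemma exists_many_good {n c : ℕ} (hn : 2 ≤ n) {α β : Type*} [Fintype α] [Fintype β] (P : α → β → Prop)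
    (hα : (Fintype.card α : ℝ) = 2 ^ n) (hβ : (Fintype.card β : ℝ) = 2 ^ n)
    (h : (4 : ℝ) ^ n ≤ (n : ℝ) ^ c *
      ((Finset.univ.filter fun p : α × β => P p.1 p.2).card : ℝ)) :
    (2 : ℝ) ^ n ≤ (n : ℝ) ^ (c + 1) * ((Finset.univ.filter fun y : β => (2 : ℝ) ^ n ≤
      (n : ℝ) ^ (c + 1) * ((Finset.univ.filter fun x : α => P x y).card : ℝ)).card : ℝ) := by
  set f : β → ℝ := fun y => ((Finset.univ.filter fun x : α => P x y).card : ℝ) with hf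
  set Y := Finset.univ.filter fun y : β => (2 : ℝ) ^ n ≤ (n : ℝ) ^ (c + 1) * f y with hY
  have hn2 : (2 : ℝ) ≤ n := by exact_mod_cast hn
  have h42 : (4 : ℝ) ^ n = 2 ^ n * 2 ^ n := by rw [← mul_pow]; norm_num
  have hpos : (0 : ℝ) < 2 ^ n := by positivity
  have hsum : ((Finset.univ.filter fun p : α × β => P p.1 p.2).card : ℝ) = ∑ y, f y := by
    simp only [hf, Finset.card_filter, Nat.cast_sum]
    rw [Fintype.sum_prod_type, Finset.sum_comm]
  have hle : ∀ y, f y ≤ 2 ^ n := by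
    intro y
    rw [← hα]
    simp only [hf]
    exact_mod_cast Finset.card_le_univ _
  have h1 : ∑ y, f y ≤ Y.card * 2 ^ n + 2 ^ n * (2 ^ n / (n : ℝ) ^ (c + 1)) := by
    rw [← Finset.sum_filter_add_sum_filter_not Finset.univ (fun y => (2 : ℝ) ^ n ≤
      (n : ℝ) ^ (c + 1) * f y), ← nsmul_eq_mul, ← hβ, ← nsmul_eq_mul]
    refine add_le_add (by rw [hβ]; exact Finset.sum_le_card_nsmul _ _ _ fun y _ => hle y) ?_
    refine (Finset.sum_le_card_nsmul _ _ ((Fintype.card β : ℝ) / (n : ℝ) ^ (c + 1))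
      fun y hy => ?_).trans ?_
    · rw [le_div_iff₀ (by positivity), hβ, mul_comm]
      exact (not_le.mp (Finset.mem_filter.mp hy).2).le.trans_eq hβ
    · rw [nsmul_eq_mul, nsmul_eq_mul]
      gcongr
      exact Finset.card_le_univ _
  rw [hsum, h42] at h
  have hnc : (0 : ℝ) < (n : ℝ) ^ c := by positivity
  have h2 : (2 : ℝ) ^ n * 2 ^ n ≤
      (n : ℝ) ^ c * (Y.card * 2 ^ n) + 2 ^ n * 2 ^ n / n := by
    calc _ ≤ _ := h
      _ ≤ (n : ℝ) ^ c * (Y.card * 2 ^ n + 2 ^ n * (2 ^ n / (n : ℝ) ^ (c + 1))) := by gcongr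
      _ = _ := by rw [pow_succ]; field_simp
  have h3 : (2 : ℝ) ^ n * 2 ^ n / n ≤ 2 ^ n * 2 ^ n / 2 := by gcongr
  have h4 : (2 : ℝ) ^ n * 2 ^ n ≤ (2 * (n : ℝ) ^ c * Y.card) * 2 ^ n := by nlinarith
  have h5 := le_of_mul_le_mul_right h4 hpos
  refine h5.trans ?_
  rw [pow_succ']
  gcongr

lemma ratSpan_image_of_eq {n e r : ℕ} (hn : 2 ≤ n) {v : Fin n → ℝ} {T : Finset (Fin n)}
    (hT : T.card ≤ r) {D : ℤ} (hD : D ≠ 0) (hDn : |D| ≤ (n : ℤ) ^ e) {m : Fin n → ℤ}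
    (hm : ∀ h, |m h| ≤ (n : ℤ) ^ e) (hmT : ∀ h ∉ T, m h = 0) {w : ℝ}
    (hw : (D : ℝ) * w = ∑ h, (m h : ℝ) * v h) :
    RatSpan n (r * (0 + e + 1) + e) (T.image v) w := by
  refine RatSpan.of_int_mul hn hD hDn ?_
  rw [hw, ← Finset.sum_subset (Finset.subset_univ T)]
  · exact ratSpan_linearCombination hn T hT (fun h _ => hm h) fun h hh =>
      ratSpan_of_mem hn 0 (Finset.mem_image_of_mem _ hh)
  · intro h _ hh
    simp [hmT h hh]

lemma card_bounded_supported {n r e : ℕ} (hn : 2 ≤ n) (T : Finset (Fin n)) (hT : T.card ≤ r) :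
    (Fintype.piFinset fun h : Fin n => if h ∈ T then Finset.Icc (-(n : ℤ) ^ e) ((n : ℤ) ^ e)
      else {0}).card ≤ n ^ ((e + 2) * r) := by
  rw [Fintype.card_piFinset]
  have h1 : ∀ h : Fin n, (if h ∈ T then Finset.Icc (-(n : ℤ) ^ e) ((n : ℤ) ^ e) else {0}).card =
      if h ∈ T then 2 * n ^ e + 1 else 1 := by
    intro h
    split_ifs
    · rw [Int.card_Icc]
      have : (n : ℤ) ^ e + 1 - -(n : ℤ) ^ e = ((2 * n ^ e + 1 : ℕ) : ℤ) := by push_cast; ring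
      rw [this, Int.toNat_natCast]
    · simp
  simp only [h1]
  rw [Finset.prod_ite]
  simp only [Finset.prod_const, one_pow, mul_one]
  have h2 : (Finset.univ.filter fun h => h ∈ T).card ≤ r := by simpa using hT
  have h3 : 2 * n ^ e + 1 ≤ n ^ (e + 2) := by
    have : 1 ≤ n ^ e := Nat.one_le_pow _ _ (by omega)
    have h4 : 4 ≤ n ^ 2 := by nlinarith
    have h5 := Nat.mul_le_mul_left (n ^ e) h4
    rw [pow_add]
    omega
  calc _ ≤ (2 * n ^ e + 1) ^ r := Nat.pow_le_pow_right (by omega) h2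
    _ ≤ (n ^ (e + 2)) ^ r := Nat.pow_le_pow_left h3 _
    _ = _ := by rw [← pow_mul]

/-- Dropping the elements hit by a short list of rarely bad indices keeps half of the set. -/
lemma half_card_le_card_avoid {α ι : Type*} {Q : ℕ} (Y : Finset α) (F : Finset ι)
    (hF : F.card ≤ Q) (E : α → ι → Prop) [∀ y i, Decidable (E y i)]
    (h : ∀ i ∈ F, 2 * Q * (Y.filter fun y => E y i).card ≤ Y.card) :
    Y.card ≤ 2 * (Y.filter fun y => ∀ i ∈ F, ¬ E y i).card := by
  by_cases hQ : Q = 0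
  · have : F = ∅ := Finset.card_eq_zero.mp (by omega)
    subst this
    simp
    omega
  have h1 : Y.filter (fun y => ¬ ∀ i ∈ F, ¬ E y i) ⊆ F.biUnion fun i => Y.filter fun y => E y i := by
    intro y hy
    rw [Finset.mem_filter] at hy
    push Not at hy
    obtain ⟨hy, i, hi, hE⟩ := hy
    exact Finset.mem_biUnion.mpr ⟨i, hi, Finset.mem_filter.mpr ⟨hy, hE⟩⟩
  have h2 : 2 * Q * (Y.filter (fun y => ¬ ∀ i ∈ F, ¬ E y i)).card ≤ Q * Y.card := by
    calc _ ≤ 2 * Q * ∑ i ∈ F, (Y.filter fun y => E y i).card :=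
          Nat.mul_le_mul_left _ ((Finset.card_le_card h1).trans Finset.card_biUnion_le)
      _ = ∑ i ∈ F, 2 * Q * (Y.filter fun y => E y i).card := Finset.mul_sum _ _ _
      _ ≤ ∑ i ∈ F, Y.card := Finset.sum_le_sum h
      _ = F.card * Y.card := by simp
      _ ≤ _ := Nat.mul_le_mul_right _ hF
  have h3 := Finset.card_filter_add_card_filter_not (s := Y) (fun y => ∀ i ∈ F, ¬ E y i)
  have h4 : 2 * (Y.filter (fun y => ¬ ∀ i ∈ F, ¬ E y i)).card ≤ Y.card := by
    have : Q * (2 * (Y.filter (fun y => ¬ ∀ i ∈ F, ¬ E y i)).card) ≤ Q * Y.card := by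
      calc _ = _ := by ring
        _ ≤ _ := h2
    exact Nat.le_of_mul_le_mul_left this (by omega)
  omega

/-- Few indices are bad for many elements. -/
lemma card_often_bad_le {α ι : Type*} [Fintype ι] [DecidableEq ι] {Q : ℕ} {b : ℝ} (Y : Finset α)
    (hY : Y.Nonempty) (E : α → Finset ι) (hE : ∀ y ∈ Y, ((E y).card : ℝ) ≤ b) :
    ((Finset.univ.filter fun i => Y.card < 2 * Q * (Y.filter fun y => i ∈ E y).card).card : ℝ) ≤
      2 * Q * b := by
  set Z := Finset.univ.filter fun i => Y.card < 2 * Q * (Y.filter fun y => i ∈ E y).card with hZ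
  have h1 : Z.card * Y.card ≤ 2 * Q * ∑ y ∈ Y, (E y).card := by
    calc Z.card * Y.card = ∑ i ∈ Z, Y.card := by simp
      _ ≤ ∑ i ∈ Z, 2 * Q * (Y.filter fun y => i ∈ E y).card :=
          Finset.sum_le_sum fun i hi => (Finset.mem_filter.mp hi).2.le
      _ ≤ ∑ i, 2 * Q * (Y.filter fun y => i ∈ E y).card :=
          Finset.sum_le_sum_of_subset (Finset.subset_univ _)
      _ = 2 * Q * ∑ i, ∑ y ∈ Y, if i ∈ E y then 1 else 0 := by
          rw [← Finset.mul_sum]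
          simp only [Finset.card_filter]
      _ = _ := by
          rw [Finset.sum_comm]
          congr 1
          refine Finset.sum_congr rfl fun y _ => ?_
          simp
  have h2 : (Z.card : ℝ) * Y.card ≤ (2 * Q * b) * Y.card := by
    calc (Z.card : ℝ) * Y.card ≤ 2 * Q * ∑ y ∈ Y, ((E y).card : ℝ) := by exact_mod_cast h1
      _ ≤ 2 * Q * ∑ y ∈ Y, b := by
          gcongr with y hy
          exact hE y hy
      _ = _ := by simp; ring
  exact le_of_mul_le_mul_right h2 (by exact_mod_cast hY.card_pos)

open Filter in
/-- Concentration of a bilinear form forces common structure on the rows, uniformly over short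
integer combinations of rows. -/
lemma bilinear_row_structure {ε : ℝ} (hε : 0 < ε) (c : ℕ) : ∃ r e : ℕ, ∀ Q : ℕ, ∀ᶠ n : ℕ in atTop,
    ∀ (A : Matrix (Fin n) (Fin n) ℝ) (a : ℝ), (4 : ℝ) ^ n ≤ (n : ℝ) ^ c *
      ((Finset.univ.filter fun xy : (Fin n → Bool) × (Fin n → Bool) =>
        ∑ i, ∑ j, A i j * signv (xy.1 i) * signv (xy.2 j) = a).card : ℝ) →
    ∃ (I₀ Iex : Finset (Fin n)) (k : ℤ), I₀.card ≤ r ∧ (Iex.card : ℝ) ≤ 2 * Q * (n : ℝ) ^ ε ∧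
      k ≠ 0 ∧ |k| ≤ (n : ℤ) ^ e ∧
      ∀ t : Fin n → ℤ, (∀ i ∈ Iex, t i = 0) → ∑ i, |t i| ≤ Q →
        ∃ (M : Fin n → ℤ) (E : Finset (Fin n)) (G : Finset ℝ), (∀ i ∉ I₀, M i = 0) ∧
          (∀ i, |M i| ≤ (n : ℤ) ^ e) ∧ (E.card : ℝ) ≤ (n : ℝ) ^ ε ∧ G.card ≤ r ∧
          ∀ j ∉ E, RatSpan n e G (∑ i, ((k * t i - M i : ℤ) : ℝ) * A i j) := by
  obtain ⟨r₁, e₁, h₁⟩ := linear_inverse_LO hε (c + 1)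
  set c₁ := c + 1 + (2 * r₁ + e₁) with hc₁
  set c₂ := c₁ + 1 + (e₁ + 1 + 2) * r₁ with hc₂
  obtain ⟨r₂, e₂, h₂⟩ := linear_inverse_LO hε c₂
  refine ⟨max r₁ r₂, max (e₁ + 1) (r₂ * (0 + e₂ + 1) + e₂), fun Q => ?_⟩
  filter_upwards [h₁, h₂, eventually_ge_atTop 2, eventually_ge_atTop Q] with n h₁ h₂ hn hQn A a hA
  have hpos : (0 : ℝ) < 2 ^ n := by positivity
  have hn2 : (2 : ℝ) ≤ n := by exact_mod_cast hn
  have hY := exists_many_good hn (fun x y : Fin n → Bool =>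
    ∑ i, ∑ j, A i j * signv (x i) * signv (y j) = a) (by simp) (by simp) hA
  set Y := Finset.univ.filter fun y : Fin n → Bool => (2 : ℝ) ^ n ≤
      (n : ℝ) ^ (c + 1) * ((Finset.univ.filter fun x : Fin n → Bool =>
        ∑ i, ∑ j, A i j * signv (x i) * signv (y j) = a).card : ℝ) with hYdef
  let Ay : (Fin n → Bool) → Fin n → ℝ := fun y i => ∑ j, A i j * signv (y j)
  have hst : ∀ y, ∃ (T : Finset (Fin n)) (D : ℕ) (E : Finset (Fin n)) (m : Fin n → Fin n → ℤ),
      y ∈ Y → T.card ≤ r₁ ∧ 1 ≤ D ∧ D ≤ n ^ e₁ ∧ (E.card : ℝ) ≤ (n : ℝ) ^ ε ∧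
        ∀ j ∉ E, (∀ h, |m j h| ≤ (n : ℤ) ^ e₁) ∧ (∀ h ∉ T, m j h = 0) ∧
          (D : ℝ) * Ay y j = ∑ h, (m j h : ℝ) * Ay y h := by
    intro y
    by_cases hy : y ∈ Y
    · have hy' := (Finset.mem_filter.mp hy).2
      simp only [sum_bilinear_eq] at hy'
      obtain ⟨T, D, E, hT, hD1, hD, hE, hm⟩ := h₁ (Ay y) a hy'
      have hm' : ∀ j, ∃ m : Fin n → ℤ, j ∉ E → (∀ h, |m h| ≤ (n : ℤ) ^ e₁) ∧
          (∀ h ∉ T, m h = 0) ∧ (D : ℝ) * Ay y j = ∑ h, (m h : ℝ) * Ay y h := by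
        intro j
        by_cases hj : j ∈ E
        · exact ⟨0, fun h => absurd hj h⟩
        · obtain ⟨m, hm⟩ := hm j hj
          exact ⟨m, fun _ => hm⟩
      choose m hm' using hm'
      exact ⟨T, D, E, m, fun _ => ⟨hT, hD1, hD, hE, fun j hj => hm' j hj⟩⟩
    · exact ⟨∅, 0, ∅, 0, fun h => absurd h hy⟩
  choose T D E m hst using hst
  obtain ⟨⟨I₀, k⟩, hIk, hY'⟩ := exists_popular_fiber (b := 2 * r₁ + e₁) hpos Y
    ((Finset.univ.filter fun T : Finset (Fin n) => T.card ≤ r₁) ×ˢ Finset.Icc 1 (n ^ e₁))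
    (fun y => (T y, D y)) (fun y hy => by
      obtain ⟨h1, h2, h3, -⟩ := hst y hy
      simp [h1, h2, h3]) (by
      rw [Finset.card_product, Nat.card_Icc, Nat.add_sub_cancel, pow_add]
      refine Nat.mul_le_mul_right _ ((card_filter_card_le n r₁).trans ?_)
      rw [pow_mul]
      exact Nat.pow_le_pow_left (by nlinarith) _) hY
  simp only [Finset.mem_product, Finset.mem_filter, Finset.mem_univ, true_and,
    Finset.mem_Icc] at hIk
  obtain ⟨hI₀, hk1, hk⟩ := hIk
  set Y' := Y.filter fun y => (T y, D y) = (I₀, k) with hY'def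
  have hY'Y : ∀ y ∈ Y', (E y).card ≤ (n : ℝ) ^ ε ∧ ∀ i ∉ E y, (∀ h, |m y i h| ≤ (n : ℤ) ^ e₁) ∧
      (∀ h ∉ I₀, m y i h = 0) ∧ (k : ℝ) * Ay y i = ∑ h, (m y i h : ℝ) * Ay y h := by
    intro y hy
    obtain ⟨hy1, hy2⟩ := Finset.mem_filter.mp hy
    obtain ⟨-, -, -, h1, h2⟩ := hst y hy1
    rw [Prod.mk.injEq] at hy2
    rw [hy2.1, hy2.2] at h2
    exact ⟨h1, h2⟩
  have hY'ne : Y'.Nonempty := by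
    rw [Finset.nonempty_iff_ne_empty]
    intro h
    rw [h] at hY'
    simp at hY'
    linarith
  have hIex := card_often_bad_le (Q := Q) Y' hY'ne E fun y hy => (hY'Y y hy).1
  set Iex := Finset.univ.filter fun i => Y'.card < 2 * Q * (Y'.filter fun y => i ∈ E y).card
    with hIexdef
  refine ⟨I₀, Iex, k, hI₀.trans (le_max_left _ _), hIex, by exact_mod_cast (by omega : k ≠ 0),
    ?_, fun t htI htQ => ?_⟩
  · rw [Nat.abs_cast]
    refine le_trans (by exact_mod_cast hk) (int_pow_le_pow hn ?_)
    exact le_trans (by omega) (le_max_left _ _)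
  set F := Finset.univ.filter fun i => t i ≠ 0 with hF
  have hFQ : F.card ≤ Q := by
    have h1 : ((F.card : ℕ) : ℤ) ≤ ∑ i, |t i| := by
      calc ((F.card : ℕ) : ℤ) = ∑ i ∈ F, 1 := by simp
        _ ≤ ∑ i ∈ F, |t i| := Finset.sum_le_sum fun i hi =>
            Int.one_le_abs (Finset.mem_filter.mp hi).2
        _ ≤ ∑ i, |t i| := Finset.sum_le_sum_of_subset_of_nonneg (Finset.subset_univ _)
            fun _ _ _ => abs_nonneg _
    exact_mod_cast h1.trans htQ
  have hhalf := half_card_le_card_avoid Y' F hFQ (fun y i => i ∈ E y) fun i hi => by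
    by_contra hlt
    exact (Finset.mem_filter.mp hi).2 (htI i (Finset.mem_filter.mpr
      ⟨Finset.mem_univ _, not_le.mp hlt⟩))
  set Y'' := Y'.filter fun y => ∀ i ∈ F, i ∉ E y with hY''def
  have hhalf' : Y'.card ≤ 2 * Y''.card := by convert hhalf
  have hY'' : (2 : ℝ) ^ n ≤ (n : ℝ) ^ (c₁ + 1) * Y''.card := by
    refine hY'.trans ?_
    rw [pow_succ, mul_assoc]
    gcongr
    calc (Y'.card : ℝ) ≤ 2 * Y''.card := by exact_mod_cast hhalf'
      _ ≤ _ := by gcongr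
  have hsumF : ∀ f : Fin n → ℝ, ∑ i, (t i : ℝ) * f i = ∑ i ∈ F, (t i : ℝ) * f i := by
    intro f
    symm
    refine Finset.sum_subset (Finset.subset_univ _) fun i _ hi => ?_
    have : t i = 0 := by simpa [hF] using hi
    rw [this]; simp
  obtain ⟨M, hM, hYM⟩ := exists_popular_fiber (b := (e₁ + 1 + 2) * r₁) hpos Y''
    (Fintype.piFinset fun h : Fin n => if h ∈ I₀ then
      Finset.Icc (-(n : ℤ) ^ (e₁ + 1)) ((n : ℤ) ^ (e₁ + 1)) else {0})
    (fun y h => ∑ i ∈ F, t i * m y i h) (fun y hy => by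
      obtain ⟨hy1, hy2⟩ := Finset.mem_filter.mp hy
      have h3 := (hY'Y y hy1).2
      rw [Fintype.mem_piFinset]
      intro h
      split_ifs with hh
      · rw [Finset.mem_Icc, ← abs_le]
        calc |∑ i ∈ F, t i * m y i h| ≤ ∑ i ∈ F, |t i * m y i h| :=
              Finset.abs_sum_le_sum_abs _ _
          _ ≤ ∑ i ∈ F, |t i| * (n : ℤ) ^ e₁ := by
              refine Finset.sum_le_sum fun i hi => ?_
              rw [abs_mul]
              exact mul_le_mul_of_nonneg_left ((h3 i (hy2 i hi)).1 h) (abs_nonneg _)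
          _ = (∑ i ∈ F, |t i|) * (n : ℤ) ^ e₁ := by rw [Finset.sum_mul]
          _ ≤ n * (n : ℤ) ^ e₁ := by
              gcongr
              refine (Finset.sum_le_sum_of_subset_of_nonneg (Finset.subset_univ _)
                fun _ _ _ => abs_nonneg _).trans (htQ.trans ?_)
              exact_mod_cast hQn
          _ = _ := by rw [pow_succ']
      · rw [Finset.mem_singleton]
        refine Finset.sum_eq_zero fun i hi => ?_
        rw [(h3 i (hy2 i hi)).2.1 h hh, mul_zero])
    (card_bounded_supported hn I₀ hI₀) hY''
  rw [Fintype.mem_piFinset] at hM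
  have hM0 : ∀ i ∉ I₀, M i = 0 := by
    intro i hi
    have := hM i
    rwa [if_neg hi, Finset.mem_singleton] at this
  have hMn : ∀ i, |M i| ≤ (n : ℤ) ^ (e₁ + 1) := by
    intro i
    have := hM i
    split_ifs at this
    · rwa [Finset.mem_Icc, ← abs_le] at this
    · rw [Finset.mem_singleton] at this
      rw [this, abs_zero]
      positivity
  set w : Fin n → ℝ := fun j => ∑ i, ((k * t i - M i : ℤ) : ℝ) * A i j with hw
  have hcount : (2 : ℝ) ^ n ≤ (n : ℝ) ^ c₂ *
      ((Finset.univ.filter fun y : Fin n → Bool => ∑ j, w j * signv (y j) = 0).card : ℝ) := by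
    refine hYM.trans ?_
    gcongr
    intro y hy
    obtain ⟨hy1, hy2⟩ := Finset.mem_filter.mp hy
    obtain ⟨hy3, hy4⟩ := Finset.mem_filter.mp hy1
    have h3 := (hY'Y y hy3).2
    refine Finset.mem_filter.mpr ⟨Finset.mem_univ _, ?_⟩
    have h4 : ∑ j, w j * signv (y j) = ∑ i, ((k * t i - M i : ℤ) : ℝ) * Ay y i := by
      simp only [hw, Ay, Finset.sum_mul, Finset.mul_sum]
      rw [Finset.sum_comm]
      exact Finset.sum_congr rfl fun _ _ => Finset.sum_congr rfl fun _ _ => by ring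
    have h5 : ∑ i, (t i : ℝ) * ((k : ℝ) * Ay y i) = ∑ h, (M h : ℝ) * Ay y h := by
      rw [hsumF, ← hy2]
      push_cast
      simp only [Finset.sum_mul]
      rw [Finset.sum_comm]
      refine Finset.sum_congr rfl fun i hi => ?_
      rw [(h3 i (hy4 i hi)).2.2, Finset.mul_sum]
      exact Finset.sum_congr rfl fun _ _ => by ring
    rw [h4]
    push_cast
    simp only [sub_mul, Finset.sum_sub_distrib]
    rw [← h5, sub_eq_zero]
    exact Finset.sum_congr rfl fun _ _ => by ring
  obtain ⟨T₂, D₂, E₂, hT₂, hD₂1, hD₂, hE₂, hm₂⟩ := h₂ w 0 hcount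
  refine ⟨M, E₂, T₂.image w, hM0, fun i => (hMn i).trans (int_pow_le_pow hn (le_max_left _ _)),
    hE₂, Finset.card_image_le.trans (hT₂.trans (le_max_right _ _)), fun j hj => ?_⟩
  obtain ⟨m₂, hm1, hm2, hm3⟩ := hm₂ j hj
  refine (ratSpan_image_of_eq hn hT₂ (D := (D₂ : ℤ)) (by exact_mod_cast (by omega : D₂ ≠ 0)) ?_ hm1
    hm2 (w := w j) (by exact_mod_cast hm3)).mono hn (le_max_right _ _) subset_rfl
  rw [Nat.abs_cast]
  exact_mod_cast hD₂

/-- A family of few sets, each covering a small fraction of `B`, admits a short list of elements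
of `B` contained in none of them. -/
lemma exists_small_transversal {α : Type*} [DecidableEq α] (B : Finset α) (hB : B.Nonempty)
    (F : Finset (Finset α)) {θ : ℝ} (hθ : 0 < θ) (m : ℕ)
    (h : ∀ f ∈ F, ((f ∩ B).card : ℝ) * θ ≤ B.card) (hF : (F.card : ℝ) < θ ^ m) :
    ∃ P ⊆ B, P.card ≤ m ∧ ∀ f ∈ F, ∃ j ∈ P, j ∉ f := by
  by_contra hcon
  have hsub : (Fintype.piFinset fun _ : Fin m => B) ⊆
      F.biUnion fun f => Fintype.piFinset fun _ : Fin m => f ∩ B := by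
    intro p hp
    rw [Fintype.mem_piFinset] at hp
    by_contra hp'
    refine hcon ⟨Finset.univ.image p, ?_, ?_, ?_⟩
    · intro j hj
      obtain ⟨i, -, rfl⟩ := Finset.mem_image.mp hj
      exact hp i
    · exact Finset.card_image_le.trans (by simp)
    · intro f hf
      by_contra hall
      push Not at hall
      refine hp' (Finset.mem_biUnion.mpr ⟨f, hf, Fintype.mem_piFinset.mpr fun i => ?_⟩)
      exact Finset.mem_inter.mpr
        ⟨hall _ (Finset.mem_image_of_mem _ (Finset.mem_univ i)), hp i⟩
  have h1 := (Finset.card_le_card hsub).trans Finset.card_biUnion_le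
  simp only [Fintype.card_piFinset, Finset.prod_const, Finset.card_univ, Fintype.card_fin] at h1
  have hBpos : (0 : ℝ) < B.card := by exact_mod_cast hB.card_pos
  have h2 : (B.card : ℝ) ^ m ≤ F.card * ((B.card : ℝ) / θ) ^ m := by
    calc (B.card : ℝ) ^ m ≤ ∑ f ∈ F, ((f ∩ B).card : ℝ) ^ m := by exact_mod_cast h1
      _ ≤ ∑ f ∈ F, ((B.card : ℝ) / θ) ^ m := by
          gcongr with f hf
          rw [le_div_iff₀ hθ]
          exact h f hf
      _ = _ := by simp
  rw [div_pow, ← mul_div_assoc, le_div_iff₀ (by positivity), mul_comm] at h2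
  exact absurd (le_of_mul_le_mul_right h2 (by positivity)) (not_le.mpr hF)

/-- The generators collected before stage `b`. -/
def stageGens {n : ℕ} (GR GC : Fin n → Finset ℝ) (row : ℕ → Fin n) (P : ℕ → Finset (Fin n))
    (b : ℕ) : Finset ℝ :=
  (Finset.range b).biUnion fun a => GR (row a) ∪ (P a).biUnion GC

/-- The requirements on the row and the columns selected at stage `b`. -/
structure IsStage {n : ℕ} (e m : ℕ) (I J : Finset (Fin n)) (x : Fin n → Fin n → ℝ)
    (ER EC : Fin n → Finset (Fin n)) (GR GC : Fin n → Finset ℝ) (F : Finset (Finset (Fin n)))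
    (row : ℕ → Fin n) (P : ℕ → Finset (Fin n)) (b : ℕ) : Prop where
  row_mem : row b ∈ I
  subset : P b ⊆ J
  card_le : (P b).card ≤ m
  not_span : ∀ j ∈ P b, ¬ RatSpan n e (stageGens GR GC row P b) (x (row b) j)
  notMem_row : ∀ a ≤ b, ∀ j ∈ P b, j ∉ ER (row a)
  notMem_col : ∀ a < b, ∀ j ∈ P a, row b ∉ EC j
  hits : ∀ f ∈ F, ∃ j ∈ P b, j ∉ f

lemma stageGens_congr {n : ℕ} {GR GC : Fin n → Finset ℝ} {row row' : ℕ → Fin n}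
    {P P' : ℕ → Finset (Fin n)} {b : ℕ} (hr : ∀ a < b, row a = row' a) (hP : ∀ a < b, P a = P' a) :
    stageGens GR GC row P b = stageGens GR GC row' P' b := by
  refine Finset.biUnion_congr rfl fun a ha => ?_
  rw [hr a (Finset.mem_range.mp ha), hP a (Finset.mem_range.mp ha)]

lemma IsStage.congr {n e m : ℕ} {I J : Finset (Fin n)} {x : Fin n → Fin n → ℝ}
    {ER EC : Fin n → Finset (Fin n)} {GR GC : Fin n → Finset ℝ} {F : Finset (Finset (Fin n))}
    {row row' : ℕ → Fin n} {P P' : ℕ → Finset (Fin n)} {b : ℕ}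
    (h : IsStage e m I J x ER EC GR GC F row P b) (hr : ∀ a ≤ b, row a = row' a)
    (hP : ∀ a ≤ b, P a = P' a) : IsStage e m I J x ER EC GR GC F row' P' b := by
  obtain ⟨h1, h2, h3, h4, h5, h6, h7⟩ := h
  rw [stageGens_congr (fun a ha => hr a ha.le) (fun a ha => hP a ha.le)] at h4
  rw [hr b le_rfl] at h1 h4 h6
  rw [hP b le_rfl] at h2 h3 h4 h5 h7
  refine ⟨h1, h2, h3, h4, fun a ha => ?_, fun a ha => ?_, h7⟩
  · rw [← hr a ha]
    exact h5 a ha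
  · rw [← hP a ha.le]
    exact h6 a ha

lemma card_stageGens_le {n ρ m : ℕ} {I J : Finset (Fin n)} {GR GC : Fin n → Finset ℝ}
    {row : ℕ → Fin n} {P : ℕ → Finset (Fin n)} {b : ℕ} (hGR : ∀ i ∈ I, (GR i).card ≤ ρ)
    (hGC : ∀ j ∈ J, (GC j).card ≤ ρ) (hrow : ∀ a < b, row a ∈ I) (hP : ∀ a < b, P a ⊆ J)
    (hPm : ∀ a < b, (P a).card ≤ m) : (stageGens GR GC row P b).card ≤ b * (ρ + m * ρ) := by
  refine (Finset.card_biUnion_le_card_mul _ _ (ρ + m * ρ) fun a ha => ?_).trans (by simp)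
  rw [Finset.mem_range] at ha
  refine (Finset.card_union_le _ _).trans (add_le_add (hGR _ (hrow a ha)) ?_)
  exact (Finset.card_biUnion_le_card_mul _ _ ρ fun j hj => hGC j (hP a ha hj)).trans
    (Nat.mul_le_mul_right _ (hPm a ha))

/-- If no small generating set works for most entries, then arbitrarily many stages exist. -/
lemma exists_stages {n e m ρ L : ℕ} (hn : 0 < n) {I J : Finset (Fin n)} {x : Fin n → Fin n → ℝ}
    {ER EC : Fin n → Finset (Fin n)} {GR GC : Fin n → Finset ℝ} {F : Finset (Finset (Fin n))}
    {β δ θ : ℝ} (hβ : 0 < β) (hθ : 0 < θ) (hGR : ∀ i ∈ I, (GR i).card ≤ ρ)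
    (hGC : ∀ j ∈ J, (GC j).card ≤ ρ) (hER : ∀ i ∈ I, ((ER i).card : ℝ) ≤ δ)
    (hEC : ∀ j ∈ J, ((EC j).card : ℝ) ≤ δ) (hδ0 : 0 ≤ δ) (hδ : (L * m : ℝ) * δ ≤ β)
    (hδ' : (L : ℝ) * δ ≤ β / 2) (hFθ : ∀ f ∈ F, (f.card : ℝ) * θ ≤ β / 2)
    (hF : (F.card : ℝ) < θ ^ m)
    (hbad : ∀ G : Finset ℝ, G.card ≤ L * (ρ + m * ρ) → β < ((I.filter fun i =>
      β < ((J.filter fun j => ¬ RatSpan n e G (x i j)).card : ℝ)).card : ℝ)) :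
    ∀ b ≤ L, ∃ (row : ℕ → Fin n) (P : ℕ → Finset (Fin n)), ∀ a < b,
      IsStage e m I J x ER EC GR GC F row P a := by
  intro b
  induction b with
  | zero => exact fun _ => ⟨fun _ => ⟨0, hn⟩, fun _ => ∅, fun a ha => absurd ha (by omega)⟩
  | succ b ih =>
    intro hb
    obtain ⟨row, P, hst⟩ := ih (by omega)
    set G := stageGens GR GC row P b with hG
    have hGcard : G.card ≤ L * (ρ + m * ρ) :=
      (card_stageGens_le hGR hGC (fun a ha => (hst a ha).row_mem) (fun a ha => (hst a ha).subset)
        fun a ha => (hst a ha).card_le).trans (Nat.mul_le_mul_right _ (by omega))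
    have hb' := hbad G hGcard
    set Z := I.filter fun i => β < ((J.filter fun j => ¬ RatSpan n e G (x i j)).card : ℝ) with hZ
    set C := (Finset.range b).biUnion fun a => (P a).biUnion EC with hC
    have hCcard : (C.card : ℝ) ≤ β := by
      refine le_trans ?_ hδ
      calc (C.card : ℝ) ≤ ∑ a ∈ Finset.range b, (((P a).biUnion EC).card : ℝ) := by
            exact_mod_cast Finset.card_biUnion_le
        _ ≤ ∑ a ∈ Finset.range b, (m : ℝ) * δ := by
            refine Finset.sum_le_sum fun a ha => ?_
            have ha' := hst a (Finset.mem_range.mp ha)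
            calc (((P a).biUnion EC).card : ℝ) ≤ ∑ j ∈ P a, ((EC j).card : ℝ) := by
                  exact_mod_cast Finset.card_biUnion_le
              _ ≤ ∑ j ∈ P a, δ := Finset.sum_le_sum fun j hj => hEC j (ha'.subset hj)
              _ = (P a).card * δ := by simp
              _ ≤ _ := by
                  gcongr
                  exact ha'.card_le
        _ = b * (m * δ) := by simp
        _ ≤ L * (m * δ) := by
            gcongr
            omega
        _ = _ := by ring
    obtain ⟨i, hiZ, hiC⟩ : ∃ i ∈ Z, i ∉ C := by
      by_contra hcon
      push Not at hcon
      have : (Z.card : ℝ) ≤ C.card := by exact_mod_cast Finset.card_le_card hcon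
      linarith
    obtain ⟨hiI, hibad⟩ := Finset.mem_filter.mp hiZ
    set row' := Function.update row b i with hrow'
    have hrowa : ∀ a < b, row a = row' a := fun a ha => by
      rw [hrow', Function.update_of_ne ha.ne]
    have hrowb : row' b = i := Function.update_self _ _ _
    have hrowI : ∀ a ≤ b, row' a ∈ I := by
      intro a ha
      rcases ha.lt_or_eq with h | rfl
      · rw [← hrowa a h]
        exact (hst a h).row_mem
      · rwa [hrowb]
    set U := (Finset.range (b + 1)).biUnion fun a => ER (row' a) with hU
    have hUcard : (U.card : ℝ) ≤ β / 2 := by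
      refine le_trans ?_ hδ'
      calc (U.card : ℝ) ≤ ∑ a ∈ Finset.range (b + 1), ((ER (row' a)).card : ℝ) := by
            exact_mod_cast Finset.card_biUnion_le
        _ ≤ ∑ a ∈ Finset.range (b + 1), δ := Finset.sum_le_sum fun a ha =>
            hER _ (hrowI a (Nat.lt_succ_iff.mp (Finset.mem_range.mp ha)))
        _ = ((b + 1 : ℕ) : ℝ) * δ := by simp
        _ ≤ _ := by gcongr
    set B := (J.filter fun j => ¬ RatSpan n e G (x i j)) \ U with hB
    have hBcard : β / 2 ≤ B.card := by
      have h1 : (J.filter fun j => ¬ RatSpan n e G (x i j)).card - U.card ≤ B.card :=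
        Finset.le_card_sdiff U _
      have h2 : ((J.filter fun j => ¬ RatSpan n e G (x i j)).card : ℝ) ≤ B.card + U.card := by
        exact_mod_cast (by omega :
          (J.filter fun j => ¬ RatSpan n e G (x i j)).card ≤ B.card + U.card)
      linarith
    have hBne : B.Nonempty := by
      rw [← Finset.card_pos]
      have : (0 : ℝ) < B.card := by linarith
      exact_mod_cast this
    obtain ⟨Pb, hPB, hPm, hPF⟩ := exists_small_transversal B hBne F hθ m (fun f hf => by
      refine le_trans ?_ ((hFθ f hf).trans hBcard)
      gcongr
      exact Finset.inter_subset_left) hF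
    set P' := Function.update P b Pb with hP'
    have hPa : ∀ a < b, P a = P' a := fun a ha => by
      rw [hP', Function.update_of_ne ha.ne]
    have hPb : P' b = Pb := Function.update_self _ _ _
    refine ⟨row', P', fun a ha => ?_⟩
    rcases (Nat.lt_succ_iff.mp ha).lt_or_eq with h | rfl
    · exact (hst a h).congr (fun a' ha' => hrowa a' (by omega)) fun a' ha' => hPa a' (by omega)
    · refine ⟨hrowI a le_rfl, ?_, by rwa [hPb], ?_, ?_, ?_, by rwa [hPb]⟩
      · rw [hPb]
        exact hPB.trans (Finset.sdiff_subset.trans (Finset.filter_subset _ _))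
      · rw [hPb, hrowb, ← stageGens_congr hrowa hPa]
        intro j hj
        exact (Finset.mem_filter.mp (Finset.mem_sdiff.mp (hPB hj)).1).2
      · intro a' ha' j hj hjE
        rw [hPb] at hj
        exact (Finset.mem_sdiff.mp (hPB hj)).2 (Finset.mem_biUnion.mpr
          ⟨a', Finset.mem_range.mpr (by omega), hjE⟩)
      · intro a' ha' j hj hjE
        rw [← hPa a' ha'] at hj
        rw [hrowb] at hjE
        exact hiC (Finset.mem_biUnion.mpr ⟨a', Finset.mem_range.mpr ha',
          Finset.mem_biUnion.mpr ⟨j, hj, hjE⟩⟩)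

/-- Small natural coefficients can be chosen so that all tails avoid the given spans. -/
lemma exists_tail_coefficients {n e S T : ℕ} (hn : 2 ≤ n) (hS : S ≤ n) {x : ℕ → Fin n → ℝ}
    {P : ℕ → Finset (Fin n)} {G : ℕ → Finset ℝ} (hP : ∀ b < T, (P b).card ≤ S)
    (hx : ∀ b < T, ∀ j ∈ P b, ¬ RatSpan n (2 * e + 2) (G b) (x b j)) :
    ∃ s : ℕ → ℕ, (∀ b, s b ≤ S) ∧ ∀ b < T, ∀ j ∈ P b,
      ¬ RatSpan n e (G b) (∑ a ∈ Finset.Ico b T, (s a : ℝ) * x a j) := by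
  suffices key : ∀ k, ∃ s : ℕ → ℕ, (∀ b, s b ≤ S) ∧ ∀ b < T, T ≤ b + k → ∀ j ∈ P b,
      ¬ RatSpan n e (G b) (∑ a ∈ Finset.Ico b T, (s a : ℝ) * x a j) by
    obtain ⟨s, hs, h⟩ := key T
    exact ⟨s, hs, fun b hb => h b hb (by omega)⟩
  intro k
  induction k with
  | zero => exact ⟨fun _ => 0, fun _ => Nat.zero_le _, fun b hb hb' => absurd hb (by omega)⟩
  | succ k ih =>
    obtain ⟨s, hs, h⟩ := ih
    by_cases hk : T ≤ k
    · exact ⟨s, hs, fun b hb _ => h b hb (by omega)⟩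
    obtain ⟨b₀, hb₀⟩ : ∃ b₀, b₀ + (k + 1) = T := ⟨T - (k + 1), by omega⟩
    set τ : Fin n → ℝ := fun j => ∑ a ∈ Finset.Ico (b₀ + 1) T, (s a : ℝ) * x a j with hτ
    obtain ⟨v, hv, hvP⟩ : ∃ v ≤ S, ∀ j ∈ P b₀, ¬ RatSpan n e (G b₀) ((v : ℝ) * x b₀ j + τ j) := by
      by_contra hcon
      push Not at hcon
      have hc : ∀ v : ℕ, ∃ j, v ≤ S → j ∈ P b₀ ∧
          RatSpan n e (G b₀) ((v : ℝ) * x b₀ j + τ j) := by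
        intro v
        by_cases hv : v ≤ S
        · obtain ⟨j, hj⟩ := hcon v hv
          exact ⟨j, fun _ => hj⟩
        · exact ⟨⟨0, by omega⟩, fun h => absurd h hv⟩
      choose f hf using hc
      obtain ⟨v, hv, v', hv', hne, hff⟩ := Finset.exists_ne_map_eq_of_card_lt_of_maps_to
        (s := Finset.range (S + 1)) (t := P b₀) (f := f) (by
          rw [Finset.card_range]
          exact Nat.lt_succ_of_le (hP b₀ (by omega))) (fun v hv =>
          (hf v (Nat.lt_succ_iff.mp (by simpa using hv))).1)
      rw [Finset.mem_range, Nat.lt_succ_iff] at hv hv'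
      obtain ⟨hj, h1⟩ := hf v hv
      have h2 := (hf v' hv').2
      rw [← hff] at h2
      refine hx b₀ (by omega) _ hj ?_
      have h3 := h1.add hn h2.neg
      have h4 : (v : ℝ) * x b₀ (f v) + τ (f v) + -((v' : ℝ) * x b₀ (f v) + τ (f v)) =
          (((v : ℤ) - v' : ℤ) : ℝ) * x b₀ (f v) := by push_cast; ring
      rw [h4] at h3
      refine (RatSpan.of_int_mul hn (e' := 1) (by omega) ?_ h3).mono hn (by omega) subset_rfl
      rw [pow_one, abs_le]
      constructor <;> omega
    refine ⟨Function.update s b₀ v, fun b => ?_, fun b hb hb' j hj => ?_⟩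
    · by_cases hbb : b = b₀
      · rw [hbb, Function.update_self]; exact hv
      · rw [Function.update_of_ne hbb]; exact hs b
    · have htail : ∀ b' > b₀, ∑ a ∈ Finset.Ico b' T, (Function.update s b₀ v a : ℝ) * x a j =
          ∑ a ∈ Finset.Ico b' T, (s a : ℝ) * x a j := by
        intro b' hb'
        refine Finset.sum_congr rfl fun a ha => ?_
        rw [Finset.mem_Ico] at ha
        rw [Function.update_of_ne (by omega)]
      by_cases hbb : b = b₀
      · subst hbb
        rw [Finset.sum_eq_sum_Ico_succ_bot hb, Function.update_self, htail _ (by omega)]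
        exact hvP j hj
      · rw [htail b (by omega)]
        exact h b hb (by omega) j hj

/-- Several families of numbers whose corrections live in a space of dimension `ρ` cannot all be
independent of the earlier generators. -/
lemma no_independent_groups (ρ e₀ eZ : ℕ) : ∃ e₃ : ℕ, ∀ {n N T : ℕ}, 2 ≤ n → N = ρ + 1 →
    T = N * ρ + 1 → ∀ (I₀ J E : Finset (Fin n)) (z : Fin N → Fin n → ℝ) (v : Fin N → Fin n → ℤ)
    (X : Fin n → Fin n → ℝ) (Gt : Fin N → Finset ℝ) (P : Fin N → Fin T → Finset (Fin n))
    (H : Fin N → Fin T → Finset ℝ), I₀.card ≤ ρ → (∀ c, ∀ i ∉ I₀, v c i = 0) →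
    (∀ c i, |v c i| ≤ (n : ℤ) ^ e₀) → (∀ c, (Gt c).card ≤ ρ) →
    (∀ c, ∀ j ∈ J, j ∉ E → RatSpan n e₀ (Gt c) (z c j + ∑ i, (v c i : ℝ) * X i j)) →
    (∀ c b, P c b ⊆ J) → (∀ c b, ∃ j ∈ P c b, j ∉ E) →
    (∀ c b b', b' < b → ∀ j ∈ P c b', ∀ c', RatSpan n eZ (H c b) (z c' j)) →
    (∀ c b, ∀ j ∈ P c b, ∀ c' < c, RatSpan n eZ (H c b) (z c' j)) →
    (∀ c b, ∀ j ∈ P c b, ¬ RatSpan n e₃ (H c b) (z c j)) → False := by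
  obtain ⟨N₀, hN₀⟩ : ∃ N₀, N₀ = ρ + 1 := ⟨_, rfl⟩
  obtain ⟨T₀, hT₀⟩ : ∃ T₀, T₀ = N₀ * ρ + 1 := ⟨_, rfl⟩
  obtain ⟨eμ, heμ⟩ : ∃ e, e = (N₀ + e₀) * N₀ := ⟨_, rfl⟩
  obtain ⟨eY, heY⟩ : ∃ e, e = N₀ * (eZ + eμ + 1) := ⟨_, rfl⟩
  obtain ⟨eR, heR⟩ : ∃ e, e = N₀ * (e₀ + eμ + 1) := ⟨_, rfl⟩
  obtain ⟨eL, heL⟩ : ∃ e, e = (T₀ + eR) * T₀ + eR := ⟨_, rfl⟩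
  refine ⟨T₀ * (eY + eL + 1) + (eY + eL) + 1 + (eL + eμ), ?_⟩
  intro n N T hn hN hT I₀ J E z v X Gt P H hI₀ hv0 hv hGt hspan hPJ hits hlow hself hnot
  obtain rfl : N = N₀ := by omega
  obtain rfl : T = T₀ := by rw [hT, hT₀]
  obtain ⟨μ, hμ0, hμ, hμv⟩ := exists_int_vec_of_card_lt (K := N) (e := e₀) hn (α := I₀)
    (β := Fin N) (by simpa using by omega) (by simp) (fun i c => v c i) (fun i c => hv c i)
  rw [← heμ] at hμ
  have hμv' : ∀ i, ∑ c, μ c * v c i = 0 := by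
    intro i
    by_cases hi : i ∈ I₀
    · rw [← hμv ⟨i, hi⟩]
      exact Finset.sum_congr rfl fun c _ => mul_comm _ _
    · exact Finset.sum_eq_zero fun c _ => by rw [hv0 c i hi, mul_zero]
  obtain ⟨c, hc, hcmax⟩ : ∃ c, μ c ≠ 0 ∧ ∀ c', c < c' → μ c' = 0 := by
    obtain ⟨c₀, hc₀⟩ := Function.ne_iff.mp hμ0
    obtain ⟨c, hc, hmax⟩ := Finset.exists_max_image (Finset.univ.filter fun c => μ c ≠ 0) id
      ⟨c₀, by simpa using hc₀⟩
    refine ⟨c, (Finset.mem_filter.mp hc).2, fun c' hc' => ?_⟩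
    by_contra h
    exact absurd (hmax c' (by simpa using h)) (not_le.mpr hc')
  choose j hjP hjE using hits c
  set y : Fin T → ℝ := fun b => ∑ c', (μ c' : ℝ) * z c' (j b) with hy
  have hyspan : ∀ b, RatSpan n eR (Finset.univ.biUnion Gt) (y b) := by
    intro b
    have h1 : y b = ∑ c', (μ c' : ℝ) * (z c' (j b) + ∑ i, (v c' i : ℝ) * X i (j b)) := by
      have h2 : ∑ c', (μ c' : ℝ) * ∑ i, (v c' i : ℝ) * X i (j b) = 0 := by
        simp only [Finset.mul_sum]
        rw [Finset.sum_comm]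
        refine Finset.sum_eq_zero fun i _ => ?_
        have h3 : ((∑ c', μ c' * v c' i : ℤ) : ℝ) = 0 := by rw [hμv' i, Int.cast_zero]
        push_cast at h3
        calc _ = (∑ c', (μ c' : ℝ) * v c' i) * X i (j b) := by
              rw [Finset.sum_mul]
              exact Finset.sum_congr rfl fun _ _ => by ring
          _ = 0 := by rw [h3, zero_mul]
      simp only [mul_add, Finset.sum_add_distrib]
      rw [h2, add_zero]
    rw [h1, heR]
    exact ratSpan_linearCombination hn _ (by simp) (fun c' _ => hμ c') fun c' _ =>
      (hspan c' (j b) (hPJ c b (hjP b)) (hjE b)).mono hn le_rfl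
        (Finset.subset_biUnion_of_mem Gt (Finset.mem_univ c'))
  have hcard : (Finset.univ.biUnion Gt).card ≤ N * ρ :=
    (Finset.card_biUnion_le_card_mul _ _ ρ fun c _ => hGt c).trans (by simp)
  obtain ⟨l, hl0, hl, hly⟩ : ∃ l : Fin T → ℤ, l ≠ 0 ∧ (∀ b, |l b| ≤ (n : ℤ) ^ eL) ∧
      ∑ b, (l b : ℝ) * y b = 0 := by
    subst hT
    rw [heL]
    exact exists_int_relation hn hcard y hyspan
  obtain ⟨b, hb, hbmax⟩ : ∃ b, l b ≠ 0 ∧ ∀ b', b < b' → l b' = 0 := by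
    obtain ⟨b₀, hb₀⟩ := Function.ne_iff.mp hl0
    obtain ⟨b, hb, hmax⟩ := Finset.exists_max_image (Finset.univ.filter fun b => l b ≠ 0) id
      ⟨b₀, by simpa using hb₀⟩
    refine ⟨b, (Finset.mem_filter.mp hb).2, fun b' hb' => ?_⟩
    by_contra h
    exact absurd (hmax b' (by simpa using h)) (not_le.mpr hb')
  have hprev : RatSpan n (T * (eY + eL + 1)) (H c b)
      (∑ b' ∈ Finset.univ.erase b, (l b' : ℝ) * y b') := by
    rw [← Finset.sum_subset (s₁ := Finset.univ.filter fun b' => b' < b)]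
    · refine ratSpan_linearCombination hn _ ((Finset.card_le_univ _).trans (by simp))
        (fun b' _ => hl b') fun b' hb' => ?_
      simp only [hy]
      rw [heY]
      exact ratSpan_linearCombination hn _ (by simp) (fun c' _ => hμ c') fun c' _ =>
        hlow c b b' (Finset.mem_filter.mp hb').2 _ (hjP b') c'
    · intro b' hb'
      exact Finset.mem_erase.mpr ⟨(Finset.mem_filter.mp hb').2.ne, Finset.mem_univ _⟩
    · intro b' hb' hb''
      rw [hbmax b' (lt_of_le_of_ne (by simpa using hb'') (Finset.ne_of_mem_erase hb').symm)]
      simp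
  have hrest : RatSpan n eY (H c b) (∑ c' ∈ Finset.univ.erase c, (μ c' : ℝ) * z c' (j b)) := by
    rw [heY, ← Finset.sum_subset (s₁ := Finset.univ.filter fun c' => c' < c)]
    · exact ratSpan_linearCombination hn _ ((Finset.card_le_univ _).trans (by simp))
        (fun c' _ => hμ c') fun c' hc' =>
          hself c b _ (hjP b) c' (Finset.mem_filter.mp hc').2
    · intro c' hc'
      exact Finset.mem_erase.mpr ⟨(Finset.mem_filter.mp hc').2.ne, Finset.mem_univ _⟩
    · intro c' hc' hc''
      rw [hcmax c' (lt_of_le_of_ne (by simpa using hc'') (Finset.ne_of_mem_erase hc').symm)]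
      simp
  refine hnot c b (j b) (hjP b) ?_
  refine RatSpan.of_int_mul hn (m := l b * μ c) (mul_ne_zero hb hc) ?_ ?_
  · rw [abs_mul, pow_add]
    gcongr
    · exact hl b
    · exact hμ c
  · have h1 := (hprev.add hn (hrest.int_mul hn (hl b))).neg
    convert h1 using 1
    rw [← Finset.add_sum_erase _ _ (Finset.mem_univ b)] at hly
    have h2 : y b = (μ c : ℝ) * z c (j b) + ∑ c' ∈ Finset.univ.erase c, (μ c' : ℝ) * z c' (j b) := by
      simp only [hy]
      rw [← Finset.add_sum_erase _ _ (Finset.mem_univ c)]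
    rw [h2] at hly
    push_cast
    linarith

/-- The coefficient vector of a short combination of rows. -/
def rowCombo {n T : ℕ} (r : Fin T → Fin n) (s : Fin T → ℕ) : Fin n → ℤ :=
  fun i => ∑ a, if r a = i then (s a : ℤ) else 0

lemma rowCombo_eq_zero {n T : ℕ} {r : Fin T → Fin n} {s : Fin T → ℕ} {i : Fin n}
    (h : ∀ a, r a ≠ i) : rowCombo r s i = 0 :=
  Finset.sum_eq_zero fun a _ => if_neg (h a)

lemma sum_abs_rowCombo_le {n T m : ℕ} {r : Fin T → Fin n} {s : Fin T → ℕ} (h : ∀ a, s a ≤ m) :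
    ∑ i, |rowCombo r s i| ≤ ((T * m : ℕ) : ℤ) := by
  have h1 : ∀ i, |rowCombo r s i| = rowCombo r s i := fun i =>
    abs_of_nonneg (Finset.sum_nonneg fun a _ => by split_ifs <;> positivity)
  have h2 : ∑ i, |rowCombo r s i| = ∑ a, (s a : ℤ) := by
    calc ∑ i, |rowCombo r s i| = ∑ i, ∑ a, if r a = i then (s a : ℤ) else 0 :=
          Finset.sum_congr rfl fun i _ => h1 i
      _ = ∑ a, ∑ i, if r a = i then (s a : ℤ) else 0 := Finset.sum_comm
      _ = _ := by simp
  rw [h2]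
  calc ∑ a, (s a : ℤ) ≤ ∑ _a : Fin T, (m : ℤ) :=
        Finset.sum_le_sum fun a _ => by exact_mod_cast h a
    _ = _ := by simp

lemma sum_rowCombo_mul {n T : ℕ} (r : Fin T → Fin n) (s : Fin T → ℕ) (f : Fin n → ℝ) :
    ∑ i, (rowCombo r s i : ℝ) * f i = ∑ a, (s a : ℝ) * f (r a) := by
  simp only [rowCombo]
  push_cast
  simp only [Finset.sum_mul]
  rw [Finset.sum_comm]
  refine Finset.sum_congr rfl fun a _ => ?_
  simp [ite_mul]

/-- An entry in a selected column lies in the span of the generators collected so far. -/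
lemma ratSpan_stageGens {n e e₀ m L : ℕ} (hn : 2 ≤ n) {I J : Finset (Fin n)}
    {x : Fin n → Fin n → ℝ} {ER EC : Fin n → Finset (Fin n)} {GR GC : Fin n → Finset ℝ}
    {F : Finset (Finset (Fin n))} {row : ℕ → Fin n} {P : ℕ → Finset (Fin n)}
    (hR : ∀ i ∈ I, ∀ j ∈ J, j ∉ ER i → RatSpan n e₀ (GR i) (x i j))
    (hC : ∀ j ∈ J, ∀ i ∈ I, i ∉ EC j → RatSpan n e₀ (GC j) (x i j))
    (hst : ∀ b < L, IsStage e m I J x ER EC GR GC F row P b) {a b b' : ℕ} (ha : a < L)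
    (hb : b < L) (hab : a < b' ∨ b < b') {j : Fin n} (hj : j ∈ P b) (hbb : b ≤ b') :
    RatSpan n e₀ (stageGens GR GC row P b') (x (row a) j) := by
  have hrow := (hst a ha).row_mem
  have hjJ := (hst b hb).subset hj
  rcases le_or_gt a b with h | h
  · have haa : a < b' := by omega
    refine (hR _ hrow j hjJ ((hst b hb).notMem_row a h j hj)).mono hn le_rfl fun g hg => ?_
    exact Finset.mem_biUnion.mpr ⟨a, Finset.mem_range.mpr haa, Finset.mem_union_left _ hg⟩
  · by_cases hbb' : b < b'
    · refine (hC j hjJ _ hrow ((hst a ha).notMem_col b h j hj)).mono hn le_rfl fun g hg => ?_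
      exact Finset.mem_biUnion.mpr ⟨b, Finset.mem_range.mpr hbb', Finset.mem_union_right _
        (Finset.mem_biUnion.mpr ⟨j, hj, hg⟩)⟩
    · omega

/-- Long sequences of stages contradict the structure of short row combinations. -/
lemma stages_contradiction (ρ e₀ : ℕ) : ∃ e : ℕ, ∀ {n N T m : ℕ}, 2 ≤ n → N = ρ + 1 →
    T = N * ρ + 1 → m ≤ n → ∀ {I J I₀ : Finset (Fin n)} {x X : Fin n → Fin n → ℝ}
    {ER EC : Fin n → Finset (Fin n)} {GR GC : Fin n → Finset ℝ}
    {V : (Fin n → ℤ) → Fin n → ℤ} {Et : (Fin n → ℤ) → Finset (Fin n)}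
    {Gt : (Fin n → ℤ) → Finset ℝ} {F : Finset (Finset (Fin n))} {row : ℕ → Fin n}
    {P : ℕ → Finset (Fin n)}, I₀.card ≤ ρ →
    (∀ i ∈ I, ∀ j ∈ J, j ∉ ER i → RatSpan n e₀ (GR i) (x i j)) →
    (∀ j ∈ J, ∀ i ∈ I, i ∉ EC j → RatSpan n e₀ (GC j) (x i j)) →
    (∀ t : Fin n → ℤ, (∀ i ∉ I, t i = 0) → ∑ i, |t i| ≤ ((T * m : ℕ) : ℤ) →
      (∀ i ∉ I₀, V t i = 0) ∧ (∀ i, |V t i| ≤ (n : ℤ) ^ e₀) ∧ (Gt t).card ≤ ρ ∧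
      ∀ j ∈ J, j ∉ Et t →
        RatSpan n e₀ (Gt t) (∑ i, (t i : ℝ) * x i j + ∑ i, (V t i : ℝ) * X i j)) →
    (∀ (r : Fin N → Fin T → Fin n) (s : Fin N → Fin T → ℕ), (∀ c a, r c a ∈ I) →
      (∀ c a, s c a ≤ m) → (Finset.univ.biUnion fun c => Et (rowCombo (r c) (s c))) ∈ F) →
    (∀ b < N * T, IsStage e m I J x ER EC GR GC F row P b) → False := by
  obtain ⟨T₀, hT₀⟩ : ∃ T₀, T₀ = (ρ + 1) * ρ + 1 := ⟨_, rfl⟩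
  obtain ⟨eZ, heZ⟩ : ∃ eZ, eZ = T₀ * (e₀ + 1 + 1) := ⟨_, rfl⟩
  obtain ⟨e₃, h₃⟩ := no_independent_groups ρ e₀ eZ
  refine ⟨2 * (e₃ + eZ + 1) + 2, ?_⟩
  intro n N T m hn hN hT hm I J I₀ x X ER EC GR GC V Et Gt F row P hI₀ hR hC ht hF hst
  have hTT : T = T₀ := by rw [hT, hT₀, hN]
  rw [← hTT] at heZ
  have hidx : ∀ (c : Fin N) (b : ℕ), b < T → c * T + b < N * T := by
    intro c b hb
    have h1 : (c + 1 : ℕ) * T ≤ N * T := Nat.mul_le_mul_right _ c.2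
    have h2 : (c + 1 : ℕ) * T = c * T + T := by ring
    omega
  have hidx' : ∀ (c c' : Fin N) (b b' : ℕ), c' < c → b' < T → c' * T + b' < c * T + b := by
    intro c c' b b' hc hb
    have h1 : (c' + 1 : ℕ) * T ≤ c * T := Nat.mul_le_mul_right _ hc
    have h2 : (c' + 1 : ℕ) * T = c' * T + T := by ring
    omega
  have hs : ∀ c : Fin N, ∃ s : ℕ → ℕ, (∀ b, s b ≤ m) ∧ ∀ b < T, ∀ j ∈ P (c * T + b),
      ¬ RatSpan n (e₃ + eZ + 1) (stageGens GR GC row P (c * T + b))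
        (∑ a ∈ Finset.Ico b T, (s a : ℝ) * x (row (c * T + a)) j) := fun c =>
    exists_tail_coefficients hn hm (P := fun b => P (c * T + b))
      (G := fun b => stageGens GR GC row P (c * T + b)) (x := fun a => x (row (c * T + a)))
      (fun b hb => (hst _ (hidx c b hb)).card_le) fun b hb => (hst _ (hidx c b hb)).not_span
  choose s hsm hs using hs
  have hs1 : ∀ c b, |((s c b : ℕ) : ℤ)| ≤ (n : ℤ) ^ 1 := by
    intro c b
    rw [Nat.abs_cast, pow_one]
    exact_mod_cast (hsm c b).trans hm
  let r : Fin N → Fin T → Fin n := fun c a => row (c * T + a)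
  let s' : Fin N → Fin T → ℕ := fun c a => s c a
  have hr : ∀ c a, r c a ∈ I := fun c a => (hst _ (hidx c a a.2)).row_mem
  have ht' := fun c => ht (rowCombo (r c) (s' c))
    (fun i hi => rowCombo_eq_zero fun a h => hi (h ▸ hr c a))
    (sum_abs_rowCombo_le fun a => hsm c a)
  let z : Fin N → Fin n → ℝ := fun c j =>
    ∑ a ∈ Finset.range T, (s c a : ℝ) * x (row (c * T + a)) j
  have hz : ∀ c j, z c j = ∑ i, (rowCombo (r c) (s' c) i : ℝ) * x i j := by
    intro c j
    rw [sum_rowCombo_mul]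
    simp only [z, r, s']
    exact Finset.sum_range fun a => (s c a : ℝ) * x (row (c * T + a)) j
  have hlin : ∀ (A : Finset ℕ) (c : Fin N) (G : Finset ℝ) (j : Fin n), A ⊆ Finset.range T →
      (∀ a ∈ A, RatSpan n e₀ G (x (row (c * T + a)) j)) →
      RatSpan n eZ G (∑ a ∈ A, (s c a : ℝ) * x (row (c * T + a)) j) := by
    intro A c G j hA h
    rw [heZ]
    have := ratSpan_linearCombination hn A (K := T) (e' := 1)
      (by simpa using Finset.card_le_card hA) (m := fun a => ((s c a : ℕ) : ℤ))
      (fun a _ => hs1 c a) h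
    simpa using this
  refine h₃ hn hN hT I₀ J (Finset.univ.biUnion fun c => Et (rowCombo (r c) (s' c))) z
    (fun c => V (rowCombo (r c) (s' c))) X (fun c => Gt (rowCombo (r c) (s' c)))
    (fun c b => P (c * T + b)) (fun c b => stageGens GR GC row P (c * T + b)) hI₀
    (fun c => (ht' c).1) (fun c => (ht' c).2.1) (fun c => (ht' c).2.2.1) ?_
    (fun c b => (hst _ (hidx c b b.2)).subset)
    (fun c b => (hst _ (hidx c b b.2)).hits _ (hF r s' hr fun c a => hsm c a)) ?_ ?_ ?_
  · intro c j hj hjE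
    rw [hz]
    exact (ht' c).2.2.2 j hj fun h => hjE (Finset.mem_biUnion.mpr ⟨c, Finset.mem_univ _, h⟩)
  · intro c b b' hb j hj c'
    have hb' : (b' : ℕ) < b := hb
    exact hlin _ c' _ j subset_rfl fun a ha =>
      ratSpan_stageGens hn hR hC hst (hidx c' a (Finset.mem_range.mp ha)) (hidx c b' b'.2)
        (Or.inr (by omega)) hj (by omega)
  · intro c b j hj c' hc'
    exact hlin _ c' _ j subset_rfl fun a ha =>
      ratSpan_stageGens hn hR hC hst (hidx c' a (Finset.mem_range.mp ha)) (hidx c b b.2)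
        (Or.inl (hidx' c c' b a hc' (Finset.mem_range.mp ha))) hj le_rfl
  · intro c b j hj hspan
    refine hs c b b.2 j hj ?_
    have hhead := hlin (Finset.range b) c (stageGens GR GC row P (c * T + b)) j
      (Finset.range_subset_range.mpr b.2.le) fun a ha =>
      ratSpan_stageGens hn hR hC hst
        (hidx c a ((Finset.mem_range.mp ha).trans b.2)) (hidx c b b.2)
        (Or.inl (by have := Finset.mem_range.mp ha; omega)) hj le_rfl
    have h1 := hspan.add hn hhead.neg
    convert h1 using 1
    simp only [z]
    rw [← Finset.sum_range_add_sum_Ico _ b.2.le]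
    ring

open Filter in
/-- Row structure, column structure and structure of short row combinations yield common
generators for almost all entries. -/
lemma exists_common_generators {ε δ : ℝ} (hδε : δ < ε) (ρ e₀ : ℕ) :
    ∃ Q ρ' e₁ : ℕ, ∀ᶠ n : ℕ in atTop, ∀ {I J I₀ : Finset (Fin n)} {x X : Fin n → Fin n → ℝ}
    {ER EC : Fin n → Finset (Fin n)} {GR GC : Fin n → Finset ℝ}
    {V : (Fin n → ℤ) → Fin n → ℤ} {Et : (Fin n → ℤ) → Finset (Fin n)}
    {Gt : (Fin n → ℤ) → Finset ℝ}, I₀.card ≤ ρ →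
    (∀ i ∈ I, ((ER i).card : ℝ) ≤ (n : ℝ) ^ δ ∧ (GR i).card ≤ ρ ∧
      ∀ j ∈ J, j ∉ ER i → RatSpan n e₀ (GR i) (x i j)) →
    (∀ j ∈ J, ((EC j).card : ℝ) ≤ (n : ℝ) ^ δ ∧ (GC j).card ≤ ρ ∧
      ∀ i ∈ I, i ∉ EC j → RatSpan n e₀ (GC j) (x i j)) →
    (∀ t : Fin n → ℤ, (∀ i ∉ I, t i = 0) → ∑ i, |t i| ≤ (Q : ℤ) →
      ((Et t).card : ℝ) ≤ (n : ℝ) ^ δ ∧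
      (∀ i ∉ I₀, V t i = 0) ∧ (∀ i, |V t i| ≤ (n : ℤ) ^ e₀) ∧ (Gt t).card ≤ ρ ∧
      ∀ j ∈ J, j ∉ Et t →
        RatSpan n e₀ (Gt t) (∑ i, (t i : ℝ) * x i j + ∑ i, (V t i : ℝ) * X i j)) →
    ∃ G : Finset ℝ, G.card ≤ ρ' ∧ ((I.filter fun i => (n : ℝ) ^ ε <
      ((J.filter fun j => ¬ RatSpan n e₁ G (x i j)).card : ℝ)).card : ℝ) ≤ (n : ℝ) ^ ε := by
  obtain ⟨e, he⟩ := stages_contradiction ρ e₀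
  obtain ⟨N, hN⟩ : ∃ N, N = ρ + 1 := ⟨_, rfl⟩
  obtain ⟨T, hT⟩ : ∃ T, T = N * ρ + 1 := ⟨_, rfl⟩
  set κ : ℝ := (ε - δ) / 2 with hκ
  have hκ0 : 0 < κ := by rw [hκ]; linarith
  obtain ⟨m, hm⟩ : ∃ m : ℕ, (2 * (T * N) : ℝ) < κ * m := by
    obtain ⟨m, hm⟩ := exists_nat_gt (2 * (T * N) / κ : ℝ)
    exact ⟨m, by rwa [div_lt_iff₀ hκ0, mul_comm (m : ℝ)] at hm⟩
  refine ⟨T * m, N * T * (ρ + m * ρ), e, ?_⟩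
  filter_upwards [eventually_ge_atTop 2, eventually_ge_atTop (m + 1),
    eventually_le_natCast_rpow (2 * N : ℝ) hκ0, eventually_le_natCast_rpow (2 * (N * T) : ℝ) hκ0,
    eventually_le_natCast_rpow ((N * T : ℕ) * m : ℝ) hκ0] with n hn hnm h1 h2 h3
  intro I J I₀ x X ER EC GR GC V Et Gt hI₀ hR hC ht
  by_contra hcon
  push Not at hcon
  have hn0 : (0 : ℝ) < n := by exact_mod_cast (by omega : 0 < n)
  have hn1 : (1 : ℝ) < n := by exact_mod_cast (by omega : 1 < n)
  set d : ℝ := (n : ℝ) ^ δ with hd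
  set θ : ℝ := (n : ℝ) ^ κ with hθ
  have hd0 : 0 < d := Real.rpow_pos_of_pos hn0 _
  have hθ1 : 1 ≤ θ := Real.one_le_rpow hn1.le hκ0.le
  have hε : (n : ℝ) ^ ε = d * θ * θ := by
    rw [hd, hθ, ← Real.rpow_add hn0, ← Real.rpow_add hn0]
    congr 1
    rw [hκ]; ring
  let f : (Fin N → Fin T → Fin n × Fin (m + 1)) → Finset (Fin n) := fun σ =>
    Finset.univ.biUnion fun c => Et (rowCombo (fun a => (σ c a).1) fun a => ((σ c a).2 : ℕ))
  set F := (Finset.univ.image f).filter fun g => (g.card : ℝ) ≤ N * d with hF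
  have hFcard : (F.card : ℝ) < θ ^ m := by
    have hc1 : F.card ≤ ((n * (m + 1)) ^ T) ^ N := by
      refine (Finset.card_filter_le _ _).trans (Finset.card_image_le.trans ?_)
      simp
    have hc2 : ((n * (m + 1)) ^ T) ^ N ≤ n ^ (2 * (T * N)) := by
      rw [← pow_mul, pow_mul n 2]
      refine Nat.pow_le_pow_left ?_ _
      rw [pow_two]
      exact Nat.mul_le_mul_left _ hnm
    calc (F.card : ℝ) ≤ (n : ℝ) ^ (2 * (T * N)) := by exact_mod_cast hc1.trans hc2
      _ = (n : ℝ) ^ (2 * (T * N) : ℝ) := by rw [← Real.rpow_natCast]; push_cast; rfl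
      _ < (n : ℝ) ^ (κ * m) := Real.rpow_lt_rpow_of_exponent_lt hn1 hm
      _ = θ ^ m := by rw [hθ, Real.rpow_mul hn0.le, Real.rpow_natCast]
  have hd1 : ((N * T : ℕ) * m : ℝ) * d ≤ (n : ℝ) ^ ε := by
    rw [hε, mul_comm, mul_assoc]
    refine mul_le_mul_of_nonneg_left (h3.trans ?_) hd0.le
    nlinarith
  have hd2 : ((N * T : ℕ) : ℝ) * d ≤ (n : ℝ) ^ ε / 2 := by
    rw [hε]
    push_cast
    have h4 : (N * T : ℝ) * d ≤ θ / 2 * d := by gcongr; linarith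
    have h5 : θ * d ≤ d * θ * θ := by nlinarith [mul_pos hd0 (by linarith : 0 < θ)]
    linarith
  have hd3 : ∀ g ∈ F, (g.card : ℝ) * θ ≤ (n : ℝ) ^ ε / 2 := by
    intro g hg
    have h4 := (Finset.mem_filter.mp hg).2
    calc (g.card : ℝ) * θ ≤ N * d * θ := by gcongr
      _ ≤ θ / 2 * d * θ := by gcongr; linarith
      _ = _ := by rw [hε]; ring
  obtain ⟨row, P, hst⟩ := exists_stages (L := N * T) (m := m) (e := e) (ρ := ρ) (F := F)
    (β := (n : ℝ) ^ ε) (δ := d) (θ := θ) (I := I) (J := J) (x := x) (ER := ER) (EC := EC)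
    (by omega) (Real.rpow_pos_of_pos hn0 _)
    (by linarith) (fun i hi => (hR i hi).2.1) (fun j hj => (hC j hj).2.1)
    (fun i hi => (hR i hi).1) (fun j hj => (hC j hj).1) hd0.le hd1 hd2 hd3 hFcard hcon _ le_rfl
  refine he hn hN hT (by omega) hI₀ (fun i hi => (hR i hi).2.2) (fun j hj => (hC j hj).2.2)
    (fun t ht0 htQ => (ht t ht0 htQ).2) (fun r s hr hs => ?_) hst
  refine Finset.mem_filter.mpr ⟨Finset.mem_image.mpr
    ⟨fun c a => (r c a, ⟨s c a, Nat.lt_succ_of_le (hs c a)⟩), Finset.mem_univ _, rfl⟩, ?_⟩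
  calc _ ≤ ∑ c : Fin N, ((Et (rowCombo (r c) (s c))).card : ℝ) := by
        exact_mod_cast Finset.card_biUnion_le
    _ ≤ ∑ _c : Fin N, d := by
        refine Finset.sum_le_sum fun c _ => (ht _ (fun i hi => ?_) ?_).1
        · exact rowCombo_eq_zero fun a h => hi (h ▸ hr c a)
        · exact sum_abs_rowCombo_le fun a => hs c a
    _ = _ := by simp

/-- A polynomial lower bound for the concentration gives many solutions for a single value. -/
lemma exists_many_solutions {n : ℕ} (hn : 2 ≤ n) {C : ℝ} {c : ℕ} (hc : C + 1 ≤ c)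
    (A : Matrix (Fin n) (Fin n) ℝ) (h : (n : ℝ) ^ (-C) ≤ rhoB n A) :
    ∃ a : ℝ, (4 : ℝ) ^ n ≤ (n : ℝ) ^ c *
      ((Finset.univ.filter fun xy : (Fin n → Bool) × (Fin n → Bool) =>
        ∑ i, ∑ j, A i j * signv (xy.1 i) * signv (xy.2 j) = a).card : ℝ) := by
  have hn0 : (0 : ℝ) < n := by exact_mod_cast (by omega : 0 < n)
  have hn2 : (2 : ℝ) ≤ n := by exact_mod_cast hn
  have hpos := Real.rpow_pos_of_pos hn0 (-C)
  obtain ⟨a, ha⟩ := exists_lt_of_lt_ciSup (lt_of_lt_of_le (half_lt_self hpos) h)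
  refine ⟨a, ?_⟩
  rw [lt_div_iff₀ (by positivity), pow_mul] at ha
  norm_num at ha
  set N := ((Finset.univ.filter fun xy : (Fin n → Bool) × (Fin n → Bool) =>
        ∑ i, ∑ j, A i j * signv (xy.1 i) * signv (xy.2 j) = a).card : ℝ)
  have hN : 0 ≤ N := Nat.cast_nonneg _
  have h1 : (n : ℝ) ^ (C + 1) ≤ (n : ℝ) ^ c := by
    rw [← Real.rpow_natCast]
    exact Real.rpow_le_rpow_of_exponent_le (by linarith) hc
  have h2 : (n : ℝ) ^ C * (n : ℝ) ^ (-C) = 1 := by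
    rw [← Real.rpow_add hn0, add_neg_cancel, Real.rpow_zero]
  have hC0 := Real.rpow_pos_of_pos hn0 C
  calc (4 : ℝ) ^ n = 2 * (n : ℝ) ^ C * ((n : ℝ) ^ (-C) / 2 * 4 ^ n) := by
        rw [show 2 * (n : ℝ) ^ C * ((n : ℝ) ^ (-C) / 2 * 4 ^ n) =
          ((n : ℝ) ^ C * (n : ℝ) ^ (-C)) * 4 ^ n by ring, h2, one_mul]
    _ ≤ 2 * (n : ℝ) ^ C * N := by gcongr
    _ ≤ n * (n : ℝ) ^ C * N := by gcongr
    _ = (n : ℝ) ^ (C + 1) * N := by rw [Real.rpow_add hn0, Real.rpow_one]; ring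
    _ ≤ _ := by gcongr

lemma card_solutions_transpose {n : ℕ} (A : Matrix (Fin n) (Fin n) ℝ) (a : ℝ) :
    (Finset.univ.filter fun xy : (Fin n → Bool) × (Fin n → Bool) =>
      ∑ i, ∑ j, A.transpose i j * signv (xy.1 i) * signv (xy.2 j) = a).card =
    (Finset.univ.filter fun xy : (Fin n → Bool) × (Fin n → Bool) =>
      ∑ i, ∑ j, A i j * signv (xy.1 i) * signv (xy.2 j) = a).card := by
  have h : ∀ xy : (Fin n → Bool) × (Fin n → Bool),
      ∑ i, ∑ j, A.transpose i j * signv (xy.1 i) * signv (xy.2 j) =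
        ∑ i, ∑ j, A i j * signv (xy.2 i) * signv (xy.1 j) := by
    intro xy
    rw [Finset.sum_comm]
    refine Finset.sum_congr rfl fun i _ => Finset.sum_congr rfl fun j _ => ?_
    rw [Matrix.transpose_apply, mul_right_comm]
  refine Finset.card_equiv (Equiv.prodComm _ _) fun xy => ?_
  rw [Finset.mem_filter, Finset.mem_filter, h]
  simp

lemma ratSpan_sub_linearCombination {n e r : ℕ} (hn : 2 ≤ n) {J₀ : Finset (Fin n)}
    (hJ₀ : J₀.card ≤ r) {l : ℤ} (hl : |l| ≤ (n : ℤ) ^ e) {L : Fin n → ℤ}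
    (hL0 : ∀ q ∉ J₀, L q = 0) (hL : ∀ q, |L q| ≤ (n : ℤ) ^ e) {W : Fin n → ℝ} {G : Finset ℝ}
    {j : Fin n} (h : RatSpan n e G (W j)) :
    RatSpan n ((e + e) + r * (0 + e + 1) + 1) (G ∪ J₀.image W)
      ((l : ℝ) * W j - ∑ q, (L q : ℝ) * W q) := by
  rw [sub_eq_add_neg]
  refine ((h.mono hn le_rfl Finset.subset_union_left).int_mul hn hl).add hn (RatSpan.neg ?_)
  rw [← Finset.sum_subset (Finset.subset_univ J₀)]
  · exact ratSpan_linearCombination hn J₀ hJ₀ (fun q _ => hL q) fun q hq =>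
      ratSpan_of_mem hn 0 (Finset.mem_union_right _ (Finset.mem_image_of_mem _ hq))
  · intro q _ hq
    simp [hL0 q hq]

lemma RatSpan.exists_fin_sum {n e : ℕ} {c : ℝ} (hn : 2 ≤ n) (hc : (e : ℝ) ≤ c) {G : Finset ℝ}
    {w : ℝ} (h : RatSpan n e G w) : ∃ p q : Fin G.card → ℤ,
      (∀ h, q h ≠ 0 ∧ |(p h : ℝ)| ≤ (n : ℝ) ^ c ∧ |(q h : ℝ)| ≤ (n : ℝ) ^ c) ∧
      w = ∑ h, ((p h : ℝ) / (q h : ℝ)) * (G.equivFin.symm h : ℝ) := by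
  obtain ⟨q, p, hq, hqn, hp, hw⟩ := h
  have hb : ∀ m : ℤ, |m| ≤ (n : ℤ) ^ e → |(m : ℝ)| ≤ (n : ℝ) ^ c := by
    intro m hm
    calc |(m : ℝ)| ≤ (n : ℝ) ^ e := by exact_mod_cast hm
      _ = (n : ℝ) ^ (e : ℝ) := (Real.rpow_natCast _ _).symm
      _ ≤ _ := Real.rpow_le_rpow_of_exponent_le (by exact_mod_cast (by omega : 1 ≤ n)) hc
  refine ⟨fun h => p (G.equivFin.symm h), fun _ => q, fun h => ⟨hq, hb _ (hp _), hb _ hqn⟩, ?_⟩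
  have hq' : (q : ℝ) ≠ 0 := by exact_mod_cast hq
  have h1 : ∑ h, ((p (G.equivFin.symm h) : ℝ) / (q : ℝ)) * (G.equivFin.symm h : ℝ) =
      ∑ g ∈ G, ((p g : ℝ) / q) * g := by
    rw [← Finset.sum_coe_sort G]
    exact Equiv.sum_comp G.equivFin.symm fun g : G => ((p g : ℝ) / q) * (g : ℝ)
  rw [h1]
  refine mul_left_cancel₀ hq' ?_
  rw [hw, Finset.mul_sum]
  exact Finset.sum_congr rfl fun g _ => by field_simp

/-- Inverse Littlewood-Offord theorem for bilinear forms, common structure. -/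
theorem inverse_LO_bilinear_commonGAP (ε C : ℝ) (hε0 : 0 < ε) (hε1 : ε < 1) (hC : 0 < C) :
    ∃ r₀ : ℕ, ∃ c : ℝ, 0 < c ∧ ∃ n₀ : ℕ, ∀ n : ℕ, n₀ ≤ n →
      ∀ A : Matrix (Fin n) (Fin n) ℝ, (n : ℝ) ^ (-C) ≤ rhoB n A →
        ∃ (I₀ J₀ I J : Finset (Fin n)) (k l : ℤ) (kk ll : Fin n → Fin n → ℤ)
          (a' : Fin n → Fin n → ℝ) (s : ℕ) (g : Fin s → ℝ),
          I₀.card ≤ r₀ ∧ J₀.card ≤ r₀ ∧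
          (n : ℝ) - c * (n : ℝ) ^ ε ≤ (I.card : ℝ) ∧
          (n : ℝ) - c * (n : ℝ) ^ ε ≤ (J.card : ℝ) ∧
          Disjoint I I₀ ∧ Disjoint J J₀ ∧
          k ≠ 0 ∧ l ≠ 0 ∧ |(k : ℝ)| ≤ (n : ℝ) ^ c ∧ |(l : ℝ)| ≤ (n : ℝ) ^ c ∧
          (∀ i ∈ I, ∀ i₀ ∈ I₀, |(kk i i₀ : ℝ)| ≤ (n : ℝ) ^ c) ∧
          (∀ j ∈ J, ∀ j₀ ∈ J₀, |(ll j₀ j : ℝ)| ≤ (n : ℝ) ^ c) ∧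
          s ≤ r₀ ∧
          ∀ i ∈ I,
            (∀ j ∈ J, A i j = a' i j / ((k : ℝ) * (l : ℝ))
                - (∑ i₀ ∈ I₀, (kk i i₀ : ℝ) * A i₀ j) / (k : ℝ)
                - (∑ j₀ ∈ J₀, (ll j₀ j : ℝ) * A i j₀) / (l : ℝ)) ∧
            ((J.filter fun j => ¬ ∃ p q : Fin s → ℤ,
                (∀ h, q h ≠ 0 ∧ |(p h : ℝ)| ≤ (n : ℝ) ^ c ∧ |(q h : ℝ)| ≤ (n : ℝ) ^ c) ∧
                a' i j = ∑ h, ((p h : ℝ) / (q h : ℝ)) * g h).card : ℝ) ≤ c * (n : ℝ) ^ ε := by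
  obtain ⟨c₀, hc₀⟩ := exists_nat_ge (C + 1)
  set δ := ε / 2 with hδdef
  have hδ : 0 < δ := by positivity
  have hδε : δ < ε := half_lt_self hε0
  obtain ⟨r, e, hrow⟩ := bilinear_row_structure hδ c₀
  obtain ⟨e₀, he₀⟩ : ∃ e₀, e₀ = (e + e) + r * (0 + e + 1) + 1 := ⟨_, rfl⟩
  obtain ⟨Q, ρ', e₁, hcore⟩ := exists_common_generators hδε (2 * r) e₀
  obtain ⟨e₂, he₂⟩ : ∃ e₂, e₂ = e₁ + (r * r) * (0 + (e + e) + 1) + 1 := ⟨_, rfl⟩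
  refine ⟨r + ρ' + r * r, (e₂ + e + 2 * (Q + 1) + r + 2 : ℕ), by positivity, ?_⟩
  set c : ℝ := ((e₂ + e + 2 * (Q + 1) + r + 2 : ℕ) : ℝ) with hc
  rw [← Filter.eventually_atTop]
  filter_upwards [Filter.eventually_ge_atTop 2, Filter.eventually_ge_atTop (Q + 1),
    hrow (Q + 1), hcore] with n hn hnQ hrow hcore
  intro A hA
  have hn1 : (1 : ℝ) ≤ n := by exact_mod_cast (by omega : 1 ≤ n)
  have hnε : 1 ≤ (n : ℝ) ^ ε := Real.one_le_rpow hn1 hε0.le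
  have hδε' : (n : ℝ) ^ δ ≤ (n : ℝ) ^ ε := Real.rpow_le_rpow_of_exponent_le hn1 hδε.le
  obtain ⟨a, ha⟩ := exists_many_solutions hn hc₀ A hA
  obtain ⟨I₀, Iex, k, hI₀, hIex, hk0, hk, hM⟩ := hrow A a ha
  obtain ⟨J₀, Jex, l, hJ₀, hJex, hl0, hl, hL⟩ := hrow A.transpose a (by
    rwa [card_solutions_transpose])
  have hM' : ∀ t : Fin n → ℤ, ∃ (M : Fin n → ℤ) (E : Finset (Fin n)) (G : Finset ℝ),
      (∀ i ∈ Iex, t i = 0) → ∑ i, |t i| ≤ ((Q + 1 : ℕ) : ℤ) → (∀ i ∉ I₀, M i = 0) ∧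
        (∀ i, |M i| ≤ (n : ℤ) ^ e) ∧ (E.card : ℝ) ≤ (n : ℝ) ^ δ ∧ G.card ≤ r ∧
        ∀ j ∉ E, RatSpan n e G (∑ i, ((k * t i - M i : ℤ) : ℝ) * A i j) := by
    intro t
    by_cases h : (∀ i ∈ Iex, t i = 0) ∧ ∑ i, |t i| ≤ ((Q + 1 : ℕ) : ℤ)
    · obtain ⟨M, E, G, h'⟩ := hM t h.1 h.2
      exact ⟨M, E, G, fun _ _ => h'⟩
    · exact ⟨0, ∅, ∅, fun h1 h2 => absurd ⟨h1, h2⟩ h⟩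
  choose M E G hM using hM'
  have hsingle : ∀ (X : Finset (Fin n)) (i : Fin n), i ∉ X →
      (∀ i' ∈ X, (Pi.single i 1 : Fin n → ℤ) i' = 0) ∧
      ∑ i', |(Pi.single i 1 : Fin n → ℤ) i'| ≤ ((Q + 1 : ℕ) : ℤ) := by
    intro X i hi
    refine ⟨fun i' hi' => Pi.single_eq_of_ne (fun h => hi (by rwa [← h])) _, ?_⟩
    rw [Finset.sum_eq_single i (fun b _ hb => by rw [Pi.single_eq_of_ne hb, abs_zero]) (by simp)]
    rw [Pi.single_eq_same, abs_one]
    push_cast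
    omega
  have hL' : ∀ j : Fin n, ∃ (L : Fin n → ℤ) (EC : Finset (Fin n)) (GC : Finset ℝ),
      j ∉ Jex → (∀ q ∉ J₀, L q = 0) ∧ (∀ q, |L q| ≤ (n : ℤ) ^ e) ∧
        (EC.card : ℝ) ≤ (n : ℝ) ^ δ ∧ GC.card ≤ r ∧
        ∀ i ∉ EC, RatSpan n e GC ((l : ℝ) * A i j - ∑ q, (L q : ℝ) * A i q) := by
    intro j
    by_cases h : j ∉ Jex
    · obtain ⟨L, EC, GC, h1, h2, h3, h4, h5⟩ := hL _ (hsingle _ j h).1 (hsingle _ j h).2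
      refine ⟨L, EC, GC, fun _ => ⟨h1, h2, h3, h4, fun i hi => ?_⟩⟩
      convert h5 i hi using 1
      push_cast
      simp only [sub_mul, Finset.sum_sub_distrib, Matrix.transpose_apply]
      congr 1
      rw [Finset.sum_eq_single j (fun b _ hb => by rw [Pi.single_eq_of_ne hb]; simp) (by simp)]
      simp
    · exact ⟨0, ∅, ∅, fun h' => absurd h' h⟩
  choose L EC GC hL using hL'
  set M₁ : Fin n → Fin n → ℤ := fun i => M (Pi.single i 1) with hM₁
  set U : Fin n → Fin n → ℝ := fun i j => (l : ℝ) * A i j - ∑ q, (L j q : ℝ) * A i q with hU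
  set x : Fin n → Fin n → ℝ := fun i j => (k : ℝ) * U i j - ∑ p, (M₁ i p : ℝ) * U p j with hx
  set W : (Fin n → ℤ) → Fin n → ℝ := fun t j => ∑ i, ((k * t i - M t i : ℤ) : ℝ) * A i j with hW
  have hWU : ∀ t j, (l : ℝ) * W t j - ∑ q, (L j q : ℝ) * W t q =
      ∑ i, ((k * t i - M t i : ℤ) : ℝ) * U i j := by
    intro t j
    simp only [hW, hU, mul_sub, Finset.mul_sum, Finset.sum_sub_distrib]
    congr 1
    · exact Finset.sum_congr rfl fun _ _ => by ring
    · rw [Finset.sum_comm]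
      exact Finset.sum_congr rfl fun _ _ => Finset.sum_congr rfl fun _ _ => by ring
  have hxW : ∀ i j, x i j =
      (l : ℝ) * W (Pi.single i 1) j - ∑ q, (L j q : ℝ) * W (Pi.single i 1) q := by
    intro i j
    rw [hWU]
    push_cast
    simp only [sub_mul, Finset.sum_sub_distrib, hx, hM₁]
    congr 1
    rw [Finset.sum_eq_single i (fun b _ hb => by rw [Pi.single_eq_of_ne hb]; simp) (by simp)]
    simp
  set I := Finset.univ \ (Iex ∪ I₀) with hI
  set J := Finset.univ \ (Jex ∪ J₀) with hJ
  have hImem : ∀ i ∈ I, i ∉ Iex ∧ i ∉ I₀ := by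
    intro i hi
    simpa [hI] using hi
  have hJmem : ∀ j ∈ J, j ∉ Jex ∧ j ∉ J₀ := by
    intro j hj
    simpa [hJ] using hj
  have hMi := fun i (hi : i ∈ I) => hM (Pi.single i 1) (hsingle _ i (hImem i hi).1).1
    (hsingle _ i (hImem i hi).1).2
  have hLj := fun j (hj : j ∈ J) => hL j (hJmem j hj).1
  have hWspan : ∀ t j, j ∈ J → RatSpan n e (G t) (W t j) → RatSpan n e₀ (G t ∪ J₀.image (W t))
      ((l : ℝ) * W t j - ∑ q, (L j q : ℝ) * W t q) := by
    intro t j hj h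
    rw [he₀]
    exact ratSpan_sub_linearCombination hn hJ₀ hl (hLj j hj).1 (hLj j hj).2.1 h
  have hcardG : ∀ {G : Finset ℝ} {X : Finset (Fin n)} (f : Fin n → ℝ), G.card ≤ r → X.card ≤ r →
      (G ∪ X.image f).card ≤ 2 * r := by
    intro G X f h1 h2
    have h3 := Finset.card_union_le G (X.image f)
    have h4 : (X.image f).card ≤ X.card := Finset.card_image_le
    omega
  obtain ⟨G', hG', hbad⟩ := hcore (I := I) (J := J) (I₀ := I₀) (x := x) (X := U)
    (ER := fun i => E (Pi.single i 1)) (EC := EC)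
    (GR := fun i => G (Pi.single i 1) ∪ J₀.image (W (Pi.single i 1)))
    (GC := fun j => GC j ∪ I₀.image fun p => U p j)
    (V := fun t p => ∑ i, t i * M₁ i p - M t p) (Et := E) (Gt := fun t => G t ∪ J₀.image (W t))
    (by omega)
    (fun i hi => ⟨(hMi i hi).2.2.1, hcardG _ (hMi i hi).2.2.2.1 hJ₀, fun j hj hjE => by
      rw [hxW]
      exact hWspan _ j hj ((hMi i hi).2.2.2.2 j hjE)⟩)
    (fun j hj => ⟨(hLj j hj).2.2.1, hcardG _ (hLj j hj).2.2.2.1 hI₀, fun i hi hiE => by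
      rw [he₀]
      exact ratSpan_sub_linearCombination (W := fun p => U p j) hn hI₀ hk (hMi i hi).1
        (hMi i hi).2.1 ((hLj j hj).2.2.2.2 i hiE)⟩)
    (by
      intro t ht htQ
      have htQ' : ∑ i, |t i| ≤ ((Q + 1 : ℕ) : ℤ) := htQ.trans (by push_cast; omega)
      have hMt := hM t (fun i hi => ht i fun h => (hImem i h).1 hi) htQ'
      refine ⟨hMt.2.2.1, fun p hp => ?_, fun p => ?_, hcardG _ hMt.2.2.2.1 hJ₀, fun j hj hjE => ?_⟩
      · rw [hMt.1 p hp, sub_zero]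
        refine Finset.sum_eq_zero fun i _ => ?_
        by_cases hi : i ∈ I
        · rw [show M₁ i p = 0 from (hMi i hi).1 p hp, mul_zero]
        · rw [ht i hi, zero_mul]
      · have h1 : |∑ i, t i * M₁ i p| ≤ Q * (n : ℤ) ^ e := by
          calc |∑ i, t i * M₁ i p| ≤ ∑ i, |t i * M₁ i p| := Finset.abs_sum_le_sum_abs _ _
            _ ≤ ∑ i, |t i| * (n : ℤ) ^ e := by
                refine Finset.sum_le_sum fun i _ => ?_
                rw [abs_mul]
                by_cases hi : i ∈ I
                · exact mul_le_mul_of_nonneg_left ((hMi i hi).2.1 p) (abs_nonneg _)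
                · rw [ht i hi]; simp
            _ = (∑ i, |t i|) * (n : ℤ) ^ e := by rw [Finset.sum_mul]
            _ ≤ _ := by gcongr
        calc |∑ i, t i * M₁ i p - M t p| ≤ |∑ i, t i * M₁ i p| + |M t p| := abs_sub _ _
          _ ≤ Q * (n : ℤ) ^ e + (n : ℤ) ^ e := add_le_add h1 (hMt.2.1 p)
          _ = ((Q + 1 : ℕ) : ℤ) * (n : ℤ) ^ e := by push_cast; ring
          _ ≤ n * (n : ℤ) ^ e := by gcongr
          _ = (n : ℤ) ^ (e + 1) := by rw [pow_succ']
          _ ≤ _ := int_pow_le_pow hn (by omega)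
      · have h1 := hWspan t j hj (hMt.2.2.2.2 j hjE)
        convert h1 using 1
        rw [hWU]
        simp only [hx, mul_sub, Finset.sum_sub_distrib]
        push_cast
        simp only [sub_mul, Finset.sum_sub_distrib, Finset.sum_mul, Finset.mul_sum]
        rw [Finset.sum_comm (f := fun i p => (t i : ℝ) * ((M₁ i p : ℝ) * U p j))]
        have h2 : ∑ i, (t i : ℝ) * ((k : ℝ) * U i j) = ∑ i, (k : ℝ) * (t i : ℝ) * U i j :=
          Finset.sum_congr rfl fun _ _ => by ring
        have h3 : ∑ p, ∑ i, (t i : ℝ) * ((M₁ i p : ℝ) * U p j) =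
            ∑ p, ∑ i, (t i : ℝ) * (M₁ i p : ℝ) * U p j :=
          Finset.sum_congr rfl fun _ _ => Finset.sum_congr rfl fun _ _ => by ring
        rw [h2, h3]
        ring)
  have hpow : ∀ m : ℤ, |m| ≤ (n : ℤ) ^ e → |(m : ℝ)| ≤ (n : ℝ) ^ c := by
    intro m hm
    rw [hc, Real.rpow_natCast]
    calc |(m : ℝ)| ≤ (n : ℝ) ^ e := by exact_mod_cast hm
      _ ≤ _ := pow_le_pow_right₀ hn1 (by omega)
  have hcompl : ∀ X Y Z : Finset (Fin n), (X.card : ℝ) ≤ 2 * ((Q + 1 : ℕ) : ℝ) * (n : ℝ) ^ δ →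
      Y.card ≤ r → (Z.card : ℝ) ≤ (n : ℝ) ^ ε →
      (n : ℝ) - c * (n : ℝ) ^ ε ≤ ((Finset.univ \ (X ∪ Y)) \ Z).card := by
    intro X Y Z hX hY hZ
    have h1 := Finset.le_card_sdiff Z (Finset.univ \ (X ∪ Y))
    have h2 := Finset.le_card_sdiff (X ∪ Y) Finset.univ
    have h3 := Finset.card_union_le X Y
    rw [Finset.card_univ, Fintype.card_fin] at h2
    have h4 : (n : ℝ) ≤ ((Finset.univ \ (X ∪ Y)) \ Z).card + X.card + Y.card + Z.card := by
      exact_mod_cast (by omega :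
        n ≤ ((Finset.univ \ (X ∪ Y)) \ Z).card + X.card + Y.card + Z.card)
    have h5 : (Y.card : ℝ) ≤ r * (n : ℝ) ^ ε := by
      calc (Y.card : ℝ) ≤ r := by exact_mod_cast hY
        _ ≤ _ := le_mul_of_one_le_right (Nat.cast_nonneg _) hnε
    have h6 : 2 * ((Q + 1 : ℕ) : ℝ) * (n : ℝ) ^ δ ≤ 2 * ((Q + 1 : ℕ) : ℝ) * (n : ℝ) ^ ε := by
      gcongr
    have h7 : (2 * ((Q + 1 : ℕ) : ℝ) + r + 1) * (n : ℝ) ^ ε ≤ c * (n : ℝ) ^ ε := by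
      gcongr
      rw [hc]
      exact_mod_cast (by omega : 2 * (Q + 1) + r + 1 ≤ e₂ + e + 2 * (Q + 1) + r + 2)
    linarith
  set Z := I.filter fun i => (n : ℝ) ^ ε <
      ((J.filter fun j => ¬ RatSpan n e₁ G' (x i j)).card : ℝ) with hZ
  set H : Finset ℝ := G' ∪ (I₀ ×ˢ J₀).image fun p => A p.1 p.2 with hH
  set a' : Fin n → Fin n → ℝ := fun i j => (k : ℝ) * l * A i j +
    l * ∑ p ∈ I₀, ((-M₁ i p : ℤ) : ℝ) * A p j + k * ∑ q ∈ J₀, ((-L j q : ℤ) : ℝ) * A i q with ha'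
  have hcardIJ : (I₀ ×ˢ J₀).card ≤ r * r := by
    rw [Finset.card_product]
    exact Nat.mul_le_mul hI₀ hJ₀
  have ha'x : ∀ i ∈ I, ∀ j ∈ J, a' i j =
      x i j + -∑ p ∈ I₀ ×ˢ J₀, ((M₁ i p.1 * L j p.2 : ℤ) : ℝ) * A p.1 p.2 := by
    intro i hi j hj
    have h1 : ∀ f : Fin n → ℝ, ∑ p, (M₁ i p : ℝ) * f p = ∑ p ∈ I₀, (M₁ i p : ℝ) * f p := by
      intro f
      symm
      refine Finset.sum_subset (Finset.subset_univ _) fun p _ hp => ?_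
      rw [show M₁ i p = 0 from (hMi i hi).1 p hp]
      simp
    have h2 : ∀ f : Fin n → ℝ, ∑ q, (L j q : ℝ) * f q = ∑ q ∈ J₀, (L j q : ℝ) * f q := by
      intro f
      symm
      refine Finset.sum_subset (Finset.subset_univ _) fun q _ hq => ?_
      rw [(hLj j hj).1 q hq]
      simp
    have h3 : ∑ p ∈ I₀, (M₁ i p : ℝ) * ((l : ℝ) * A p j) = l * ∑ p ∈ I₀, (M₁ i p : ℝ) * A p j := by
      rw [Finset.mul_sum]
      exact Finset.sum_congr rfl fun _ _ => by ring
    have h4 : ∑ p ∈ I₀, ∑ q ∈ J₀, (M₁ i p : ℝ) * (L j q : ℝ) * A p q =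
        ∑ p ∈ I₀, (M₁ i p : ℝ) * ∑ q ∈ J₀, (L j q : ℝ) * A p q := by
      refine Finset.sum_congr rfl fun p _ => ?_
      rw [Finset.mul_sum]
      exact Finset.sum_congr rfl fun _ _ => by ring
    simp only [ha', hx, h1, hU, h2, Finset.sum_product]
    push_cast
    simp only [mul_sub, Finset.sum_sub_distrib, neg_mul, Finset.sum_neg_distrib, h3, h4]
    ring
  have ha'span : ∀ i ∈ I, ∀ j ∈ J, RatSpan n e₁ G' (x i j) → RatSpan n e₂ H (a' i j) := by
    intro i hi j hj h
    rw [ha'x i hi j hj, he₂]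
    refine (h.mono hn le_rfl Finset.subset_union_left).add hn (RatSpan.neg ?_)
    refine ratSpan_linearCombination hn _ hcardIJ (fun p _ => ?_) fun p hp =>
      ratSpan_of_mem hn 0 (Finset.mem_union_right _ (Finset.mem_image.mpr ⟨p, hp, rfl⟩))
    rw [abs_mul, pow_add]
    gcongr
    · exact (hMi i hi).2.1 _
    · exact (hLj j hj).2.1 _
  have hkr : (k : ℝ) ≠ 0 := by exact_mod_cast hk0
  have hlr : (l : ℝ) ≠ 0 := by exact_mod_cast hl0
  refine ⟨I₀, J₀, I \ Z, J, k, l, fun i p => -M₁ i p, fun q j => -L j q, a', H.card,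
    fun h => (H.equivFin.symm h : ℝ), by omega, by omega, hcompl _ _ _ hIex hI₀ hbad, ?_, ?_, ?_,
    hk0, hl0, hpow _ hk, hpow _ hl, fun i hi p _ => ?_, fun j hj q _ => ?_, ?_,
    fun i hi => ⟨fun j _ => ?_, ?_⟩⟩
  · simpa using hcompl Jex J₀ ∅ hJex hJ₀ (by simp; positivity)
  · rw [Finset.disjoint_left]
    exact fun i hi => (hImem i (Finset.mem_sdiff.mp hi).1).2
  · rw [Finset.disjoint_left]
    exact fun j hj => (hJmem j hj).2
  · refine hpow _ ?_
    rw [abs_neg]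
    exact (hMi i (Finset.mem_sdiff.mp hi).1).2.1 p
  · refine hpow _ ?_
    rw [abs_neg]
    exact (hLj j hj).2.1 q
  · have h1 := Finset.card_union_le G' ((I₀ ×ˢ J₀).image fun p => A p.1 p.2)
    have h2 : ((I₀ ×ˢ J₀).image fun p => A p.1 p.2).card ≤ (I₀ ×ˢ J₀).card :=
      Finset.card_image_le
    have h3 : H.card ≤ _ := h1
    omega
  · simp only [ha']
    field_simp
    ring
  · obtain ⟨hiI, hiZ⟩ := Finset.mem_sdiff.mp hi
    have h1 : ((J.filter fun j => ¬ RatSpan n e₁ G' (x i j)).card : ℝ) ≤ (n : ℝ) ^ ε := by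
      by_contra h
      exact hiZ (Finset.mem_filter.mpr ⟨hiI, not_le.mp h⟩)
    have h2 : (n : ℝ) ^ ε ≤ c * (n : ℝ) ^ ε := by
      refine le_mul_of_one_le_left (by positivity) ?_
      rw [hc]
      exact_mod_cast (by omega : 1 ≤ e₂ + e + 2 * (Q + 1) + r + 2)
    refine le_trans ?_ (h1.trans h2)
    refine Nat.cast_le.mpr (Finset.card_le_card fun j hj => ?_)
    obtain ⟨hjJ, hj⟩ := Finset.mem_filter.mp hj
    refine Finset.mem_filter.mpr ⟨hjJ, fun hspan => hj ?_⟩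
    refine (ha'span i hiI j hjJ hspan).exists_fin_sum hn ?_
    rw [hc]
    exact_mod_cast (by omega : e₂ ≤ e₂ + e + 2 * (Q + 1) + r + 2)


end
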